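/- arXiv:2603.16324 — 2 statements merged into one kernel-verified Lean document; each statement's English description precedes it below -/
import Mathlib

section
/- Under the gap condition, set φ := u₁ and s(x) := sin(4π⟨w,x⟩), and define S₂ : ℝⁿ → ℝ by S₂ := λ₁·φ²·u₂ − (8λ₁/(3D))·φ·s + (n−2)·φ·⟨∇φ, ∇u₂⟩ − ((n−2)/(3λ₁))·( 4λ₁·φ·(−λ₁/D)·s + λ₁·⟨∇φ, ∇(s/D)⟩ ) − ((n−2)²/(6λ₁))·⟨∇φ, ∇(−(λ₁/D)·s)⟩. Then for every x ∈ ℝⁿ, S₂(x) = (λ₁·(n² − 5n + 1)/(6D))·u₂(x) + (√2·λ₁·(n² − 7n + 15)/(6·D^{3/2}))·cos(6π⟨w,x⟩). -/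
open MeasureTheory Real Filter Topology Asymptotics
open scoped InnerProductSpace

noncomputable section

/-- Euclidean space `ℝⁿ`. -/
abbrev E (n : ℕ) := EuclideanSpace ℝ (Fin n)

/-- The vector `A·t ∈ ℝⁿ`. -/
def matVec {n : ℕ} (A : Matrix (Fin n) (Fin n) ℝ) (t : Fin n → ℝ) : E n :=
  (WithLp.equiv 2 (Fin n → ℝ)).symm (A.mulVec t)

/-- The lattice `Γ = A·ℤⁿ`. -/
def lattice {n : ℕ} (A : Matrix (Fin n) (Fin n) ℝ) : Set (E n) :=
  {x | ∃ m : Fin n → ℤ, x = matVec A fun i => (m i : ℝ)}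

/-- The dual lattice `Γ* = {w : ⟨w,x⟩ ∈ ℤ for all x ∈ Γ}`. -/
def dualLattice {n : ℕ} (Γ : Set (E n)) : Set (E n) :=
  {w | ∀ x ∈ Γ, ∃ k : ℤ, ⟪w, x⟫_ℝ = (k : ℝ)}

/-- `f` is `Γ`-periodic. -/
def IsPeriodic {n : ℕ} (Γ : Set (E n)) (f : E n → ℝ) : Prop :=
  ∀ x : E n, ∀ γ ∈ Γ, f (x + γ) = f x

/-- The fundamental domain `F = A·[0,1)ⁿ`. -/
def fundDomain {n : ℕ} (A : Matrix (Fin n) (Fin n) ℝ) : Set (E n) :=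
  {x | ∃ t : Fin n → ℝ, (∀ i, t i ∈ Set.Ico (0:ℝ) 1) ∧ x = matVec A t}

/-- Geometer's (nonnegative) Laplacian: `Δ f = -∑ᵢ ∂²f/∂xᵢ²`. -/
def lap {n : ℕ} (f : E n → ℝ) (x : E n) : ℝ :=
  -∑ i : Fin n, iteratedFDeriv ℝ 2 f x ![EuclideanSpace.single i 1, EuclideanSpace.single i 1]

/-- The gap condition: `w ∈ Γ* \ {0}` and `|w| < |v|` for every `v ∈ Γ* \ {0, w, -w}`. -/
def GapCondition {n : ℕ} (Γ : Set (E n)) (w : E n) : Prop :=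
  w ∈ dualLattice Γ ∧ w ≠ 0 ∧
    ∀ v ∈ dualLattice Γ, v ≠ 0 → v ≠ w → v ≠ -w → ‖w‖ < ‖v‖

/-- `u₁(x) = √2·D^{-1/2}·sin(2π⟨w,x⟩)` where `D = |det A|`. -/
def uSin {n : ℕ} (A : Matrix (Fin n) (Fin n) ℝ) (w : E n) : E n → ℝ :=
  fun x => Real.sqrt 2 / Real.sqrt |A.det| * Real.sin (2 * π * ⟪w, x⟫_ℝ)

/-- `u₂(x) = √2·D^{-1/2}·cos(2π⟨w,x⟩)` where `D = |det A|`. -/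
def uCos {n : ℕ} (A : Matrix (Fin n) (Fin n) ℝ) (w : E n) : E n → ℝ :=
  fun x => Real.sqrt 2 / Real.sqrt |A.det| * Real.cos (2 * π * ⟪w, x⟫_ℝ)

/-- The gradient of `x ↦ c · sin (a⟨w, x⟩)`. -/
theorem gradient_const_mul_sin_inner {n : ℕ} (w : E n) (c a : ℝ) (x : E n) :
    gradient (fun y : E n => c * Real.sin (a * ⟪w, y⟫_ℝ)) x
      = (c * (a * Real.cos (a * ⟪w, x⟫_ℝ))) • w := by
  apply HasGradientAt.gradient
  rw [hasGradientAt_iff_hasFDerivAt]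
  have h : HasFDerivAt (fun y : E n => ⟪w, y⟫_ℝ) (innerSL ℝ w) x := (innerSL ℝ w).hasFDerivAt
  refine (((h.const_mul a).sin).const_mul c).congr_fderiv ?_
  ext v
  simp [innerSL_apply_apply]
  ring

/-- The gradient of `x ↦ c · cos (a⟨w, x⟩)`. -/
theorem gradient_const_mul_cos_inner {n : ℕ} (w : E n) (c a : ℝ) (x : E n) :
    gradient (fun y : E n => c * Real.cos (a * ⟪w, y⟫_ℝ)) x
      = (-(c * (a * Real.sin (a * ⟪w, x⟫_ℝ)))) • w := by
  apply HasGradientAt.gradient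
  rw [hasGradientAt_iff_hasFDerivAt]
  have h : HasFDerivAt (fun y : E n => ⟪w, y⟫_ℝ) (innerSL ℝ w) x := (innerSL ℝ w).hasFDerivAt
  refine (((h.const_mul a).cos).const_mul c).congr_fderiv ?_
  ext v
  simp [innerSL_apply_apply]
  ring

/-- Explicit computation of `S_{1,φ}(u₂)` for `φ = u₁` on the flat torus. -/
theorem statement5 (n : ℕ) (hn : 2 ≤ n) (A : Matrix (Fin n) (Fin n) ℝ) (hA : IsUnit A.det)
    (w : E n) (hgap : GapCondition (lattice A) w)
    (D lam₁ : ℝ) (hD : D = |A.det|) (hlam₁ : lam₁ = 4 * π ^ 2 * ‖w‖ ^ 2)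
    (φ u₂ s : E n → ℝ) (hφ : φ = uSin A w) (hu₂ : u₂ = uCos A w)
    (hs : s = fun x => Real.sin (4 * π * ⟪w, x⟫_ℝ))
    (S₂ : E n → ℝ)
    (hS₂ : S₂ = fun x =>
      lam₁ * (φ x) ^ 2 * u₂ x
      - (8 * lam₁ / (3 * D)) * φ x * s x
      + ((n : ℝ) - 2) * φ x * ⟪gradient φ x, gradient u₂ x⟫_ℝ
      - (((n : ℝ) - 2) / (3 * lam₁)) *
          (4 * lam₁ * φ x * (-(lam₁ / D) * s x)
            + lam₁ * ⟪gradient φ x, gradient (fun y => s y / D) x⟫_ℝ)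
      - (((n : ℝ) - 2) ^ 2 / (6 * lam₁)) *
          ⟪gradient φ x, gradient (fun y => -(lam₁ / D) * s y) x⟫_ℝ) :
    ∀ x : E n, S₂ x =
      (lam₁ * ((n : ℝ) ^ 2 - 5 * (n : ℝ) + 1) / (6 * D)) * u₂ x
      + (Real.sqrt 2 * lam₁ * ((n : ℝ) ^ 2 - 7 * (n : ℝ) + 15) / (6 * D ^ ((3 : ℝ) / 2))) *
          Real.cos (6 * π * ⟪w, x⟫_ℝ) := by
  intro x
  have hDpos : 0 < D := hD ▸ abs_pos.mpr hA.ne_zero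
  have hw : ‖w‖ ≠ 0 := norm_ne_zero_iff.mpr hgap.2.1
  have hlam₁0 : lam₁ ≠ 0 := by rw [hlam₁]; have := pi_ne_zero; positivity
  have hpow : D ^ ((3 : ℝ) / 2) = D * Real.sqrt D := by
    rw [show (3 : ℝ) / 2 = 1 + 1 / 2 by norm_num, rpow_add hDpos, rpow_one, ← sqrt_eq_rpow]
  obtain ⟨c, hc⟩ : ∃ c, c = Real.sqrt 2 / Real.sqrt D := ⟨_, rfl⟩
  have hc2 : c ^ 2 = 2 / D := by
    rw [hc, div_pow, sq_sqrt zero_le_two, sq_sqrt hDpos.le]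
  have hcoef : Real.sqrt 2 * lam₁ * ((n : ℝ) ^ 2 - 7 * (n : ℝ) + 15) / (6 * D ^ ((3 : ℝ) / 2))
      = lam₁ * c / D * (((n : ℝ) ^ 2 - 7 * (n : ℝ) + 15) / 6) := by
    have := (sqrt_pos.mpr hDpos).ne'
    rw [hpow, hc]
    field_simp
  have hsD : (fun y => s y / D) = fun y => D⁻¹ * Real.sin (4 * π * ⟪w, y⟫_ℝ) := by
    funext y; rw [hs, div_eq_inv_mul]
  have hsl : (fun y => -(lam₁ / D) * s y)
      = fun y => -(lam₁ / D) * Real.sin (4 * π * ⟪w, y⟫_ℝ) := by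
    rw [hs]
  have hφ' : φ = fun y => c * Real.sin (2 * π * ⟪w, y⟫_ℝ) := by rw [hφ, hc, hD]; rfl
  have hu₂' : u₂ = fun y => c * Real.cos (2 * π * ⟪w, y⟫_ℝ) := by rw [hu₂, hc, hD]; rfl
  rw [hcoef, hS₂]
  beta_reduce
  rw [hsD, hsl, hφ', hu₂', hs]
  simp only [gradient_const_mul_sin_inner, gradient_const_mul_cos_inner, inner_smul_left,
    inner_smul_right, real_inner_self_eq_norm_sq, conj_trivial]
  have hw2 : ‖w‖ ^ 2 = lam₁ / (4 * π ^ 2) := by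
    rw [hlam₁]; have := pi_ne_zero; field_simp
  rw [hw2]
  obtain ⟨θ, hθ⟩ : ∃ θ, θ = 2 * π * ⟪w, x⟫_ℝ := ⟨_, rfl⟩
  rw [show 4 * π * ⟪w, x⟫_ℝ = 2 * θ by rw [hθ]; ring,
    show 6 * π * ⟪w, x⟫_ℝ = 3 * θ by rw [hθ]; ring, ← hθ, sin_two_mul, cos_two_mul,
    cos_three_mul]
  have hS : Real.sin θ ^ 2 = 1 - Real.cos θ ^ 2 := Real.sin_sq θ
  have hDc : D = 2 / c ^ 2 := by rw [hc2]; field_simp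
  have hc0 : c ≠ 0 := by rintro rfl; simp at hDc; exact hDpos.ne' hDc
  have hπ := pi_ne_zero
  rw [hDc]
  generalize Real.cos θ = C at *
  generalize Real.sin θ = S at *
  field_simp
  ring_nf
  simp only [hS]
  ring
end
end

section
/- Under the gap condition, let φ : ℝⁿ → ℝ be a smooth Γ-periodic function satisfying ∫_F φ dx = 0 and, for all i, j ∈ {1,2}, ∫_F φ·u_i·u_j dx = 0 and ∫_F u_i·⟨∇φ, ∇u_j⟩ dx = 0. Then, as t → 0, λ₁(t)·V_φ(t)^{2/n} = λ₁·D^{2/n} + o(t); that is, the first variation of the normalized first eigenvalue along the conformal deformation g_t = e^{tφ}g_Γ vanishes. -/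
open MeasureTheory Real Filter Topology Asymptotics
open scoped InnerProductSpace

noncomputable section

/-- The volume `V_φ(t) = ∫_F e^{ntφ/2} dx` of the conformal metric `e^{tφ}g_Γ`. -/
def confVol {n : ℕ} (A : Matrix (Fin n) (Fin n) ℝ) (φ : E n → ℝ) (t : ℝ) : ℝ :=
  ∫ x in fundDomain A, Real.exp ((n : ℝ) * t * φ x / 2)

/-- The first positive Laplace eigenvalue `λ₁(t)` of the conformal metric `e^{tφ}g_Γ`,
as the infimum of the Rayleigh quotient over smooth `Γ`-periodic functions that are
not identically zero and have zero mean with respect to the conformal volume measure. -/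
def confLam1 {n : ℕ} (A : Matrix (Fin n) (Fin n) ℝ) (φ : E n → ℝ) (t : ℝ) : ℝ :=
  sInf {r : ℝ | ∃ f : E n → ℝ, ContDiff ℝ (⊤ : ℕ∞) f ∧ IsPeriodic (lattice A) f ∧ f ≠ 0 ∧
    (∫ x in fundDomain A, f x * Real.exp ((n : ℝ) * t * φ x / 2)) = 0 ∧
    r = (∫ x in fundDomain A, ‖gradient f x‖ ^ 2 * Real.exp (((n : ℝ) - 2) * t * φ x / 2)) /
        (∫ x in fundDomain A, (f x) ^ 2 * Real.exp ((n : ℝ) * t * φ x / 2))}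

section Lattice

variable {n : ℕ} {A : Matrix (Fin n) (Fin n) ℝ}

/-- The linear automorphism `t ↦ A·t` as a map `ℝⁿ ≃ E n`. -/
def matEquiv (A : Matrix (Fin n) (Fin n) ℝ) (hA : IsUnit A.det) : (Fin n → ℝ) ≃ₗ[ℝ] E n :=
  (A.toLinearEquiv' (A.invertibleOfIsUnitDet hA)).trans (WithLp.linearEquiv 2 ℝ (Fin n → ℝ)).symm

lemma matEquiv_apply (hA : IsUnit A.det) (t : Fin n → ℝ) : matEquiv A hA t = matVec A t := rfl

/-- The basis of `E n` given by the columns of `A`. -/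
def colBasis (A : Matrix (Fin n) (Fin n) ℝ) (hA : IsUnit A.det) : Module.Basis (Fin n) ℝ (E n) :=
  Module.Basis.ofEquivFun (matEquiv A hA).symm

lemma fundDomain_eq (hA : IsUnit A.det) :
    fundDomain A = ZSpan.fundamentalDomain (colBasis A hA) := by
  ext x
  rw [ZSpan.mem_fundamentalDomain]
  constructor
  · rintro ⟨t, ht, rfl⟩ i
    rw [← matEquiv_apply hA]
    simpa [colBasis] using ht i
  · intro h
    refine ⟨(matEquiv A hA).symm x, fun i => by simpa [colBasis] using h i, ?_⟩
    rw [← matEquiv_apply hA, LinearEquiv.apply_symm_apply]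

lemma mem_lattice_iff (hA : IsUnit A.det) (x : E n) :
    x ∈ lattice A ↔ x ∈ Submodule.span ℤ (Set.range (colBasis A hA)) := by
  rw [Module.Basis.mem_span_iff_repr_mem]
  constructor
  · rintro ⟨m, rfl⟩ i
    rw [← matEquiv_apply hA]
    exact ⟨m i, by simp [colBasis]⟩
  · intro h
    choose m hm using h
    refine ⟨m, ?_⟩
    rw [← matEquiv_apply hA, ← LinearEquiv.symm_apply_eq]
    ext i
    simpa [colBasis] using (hm i).symm

lemma isBounded_fundDomain (hA : IsUnit A.det) : Bornology.IsBounded (fundDomain A) := by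
  rw [fundDomain_eq hA]
  exact ZSpan.fundamentalDomain_isBounded _

lemma measurableSet_fundDomain (hA : IsUnit A.det) : MeasurableSet (fundDomain A) := by
  rw [fundDomain_eq hA]
  exact ZSpan.fundamentalDomain_measurableSet _

lemma integrableOn_fundDomain (hA : IsUnit A.det) {V : Type*} [NormedAddCommGroup V]
    {f : E n → V} (hf : Continuous f) : IntegrableOn f (fundDomain A) := by
  have hc : IsCompact (closure (fundDomain A)) := (isBounded_fundDomain hA).isCompact_closure
  exact (hf.continuousOn.integrableOn_compact hc).mono_set subset_closure

lemma isFiniteMeasure_fundDomain (hA : IsUnit A.det) :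
    IsFiniteMeasure (volume.restrict (fundDomain A)) :=
  ⟨by simpa using (isBounded_fundDomain hA).measure_lt_top⟩

/-- Every point is congruent modulo the lattice to a point of the fundamental domain. -/
lemma exists_mem_fundDomain (hA : IsUnit A.det) (x : E n) :
    ∃ γ ∈ lattice A, x + γ ∈ fundDomain A := by
  refine ⟨-(ZSpan.floor (colBasis A hA) x : E n), ?_, ?_⟩
  · rw [mem_lattice_iff hA]
    exact neg_mem (ZSpan.floor (colBasis A hA) x).2
  · rw [fundDomain_eq hA, ← sub_eq_add_neg]
    exact ZSpan.fract_mem_fundamentalDomain (colBasis A hA) x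

lemma exists_bound_of_periodic (hA : IsUnit A.det) {V : Type*} [NormedAddCommGroup V]
    {f : E n → V} (hf : Continuous f) (hp : ∀ x, ∀ γ ∈ lattice A, f (x + γ) = f x) :
    ∃ C : ℝ, ∀ x, ‖f x‖ ≤ C := by
  have hc : IsCompact (closure (fundDomain A)) := (isBounded_fundDomain hA).isCompact_closure
  obtain ⟨C, hC⟩ := hc.exists_bound_of_continuousOn hf.continuousOn
  refine ⟨C, fun x => ?_⟩
  obtain ⟨γ, hγ, hx⟩ := exists_mem_fundDomain hA x
  rw [← hp x γ hγ]
  exact hC _ (subset_closure hx)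

lemma isAddFundamentalDomain_fundDomain (hA : IsUnit A.det) :
    IsAddFundamentalDomain (Submodule.span ℤ (Set.range (colBasis A hA))).toAddSubgroup
      (fundDomain A) (volume : Measure (E n)) := by
  rw [fundDomain_eq hA]
  exact ZSpan.isAddFundamentalDomain' _ _

instance countable_span (hA : IsUnit A.det) :
    Countable (Submodule.span ℤ (Set.range (colBasis A hA))).toAddSubgroup :=
  inferInstanceAs (Countable (Submodule.span ℤ (Set.range (colBasis A hA))))

open scoped Pointwise in
lemma integral_fundDomain_add (hA : IsUnit A.det) {V : Type*} [NormedAddCommGroup V]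
    [NormedSpace ℝ V] {f : E n → V} (hp : ∀ x, ∀ γ ∈ lattice A, f (x + γ) = f x) (v : E n) :
    ∫ x in fundDomain A, f (x + v) = ∫ x in fundDomain A, f x := by
  have hF := isAddFundamentalDomain_fundDomain hA
  have hF' : IsAddFundamentalDomain (Submodule.span ℤ (Set.range (colBasis A hA))).toAddSubgroup
      ((fun x => x + v) '' fundDomain A) (volume : Measure (E n)) := by
    have h1 : (fun x => x + v) '' fundDomain A = v +ᵥ fundDomain A :=
      Set.image_congr fun x _ => add_comm x v
    rw [h1]
    exact hF.vadd_of_comm v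
  have h2 := hF'.setIntegral_eq hF (f := f) (by
    intro g x
    rw [AddSubgroup.vadd_def, vadd_eq_add, add_comm]
    exact hp x _ ((mem_lattice_iff hA _).2 g.2))
  rw [← h2, (measurePreserving_add_right volume v).setIntegral_image_emb
    (measurableEmbedding_addRight v)]

lemma eq_zero_of_ae_fundDomain (hA : IsUnit A.det) {f : E n → ℝ} (hf : Continuous f)
    (hp : IsPeriodic (lattice A) f) (h : f =ᵐ[volume.restrict (fundDomain A)] 0) : f = 0 := by
  have hF := isAddFundamentalDomain_fundDomain hA
  have h0 : volume {x | f x ≠ 0} = 0 := by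
    refine hF.measure_zero_of_invariant _ ?_ ?_
    · intro g
      ext x
      rw [Set.mem_vadd_set_iff_neg_vadd_mem, AddSubgroup.vadd_def, vadd_eq_add, add_comm]
      simp only [Set.mem_ofPred_eq, ne_eq]
      rw [hp x _ ((mem_lattice_iff hA _).2 (-g).2)]
    · rw [← Measure.restrict_apply' (measurableSet_fundDomain hA)]
      exact h
  exact (hf.ae_eq_iff_eq volume continuous_const).1 h0

lemma periodic_fderiv {V : Type*} [NormedAddCommGroup V] [NormedSpace ℝ V] {f : E n → V}
    (hp : ∀ x, ∀ γ ∈ lattice A, f (x + γ) = f x) :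
    ∀ x, ∀ γ ∈ lattice A, fderiv ℝ f (x + γ) = fderiv ℝ f x := by
  intro x γ hγ
  rw [← fderiv_comp_add_right γ]
  congr 1
  ext y
  exact hp y γ hγ

/-- The integral of a directional derivative of a periodic function vanishes. -/
lemma integral_fderiv_eq_zero (hA : IsUnit A.det) {V : Type*} [NormedAddCommGroup V]
    [NormedSpace ℝ V] [CompleteSpace V] {f : E n → V} (hf : ContDiff ℝ 1 f)
    (hp : ∀ x, ∀ γ ∈ lattice A, f (x + γ) = f x) (v : E n) :
    ∫ x in fundDomain A, fderiv ℝ f x v = 0 := by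
  have := isFiniteMeasure_fundDomain hA
  have hcd : Continuous fun x => fderiv ℝ f x v :=
    (hf.continuous_fderiv one_ne_zero).clm_apply continuous_const
  obtain ⟨C, hC⟩ := exists_bound_of_periodic hA hcd
    (fun x γ hγ => by rw [periodic_fderiv hp x γ hγ])
  have key := hasDerivAt_integral_of_dominated_loc_of_deriv_le (𝕜 := ℝ)
    (μ := volume.restrict (fundDomain A)) (F := fun s x => f (x + s • v)) (x₀ := (0 : ℝ))
    (s := Set.univ) (bound := fun _ => C) (F' := fun s x => fderiv ℝ f (x + s • v) v)
    Filter.univ_mem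
    (Eventually.of_forall fun s => (hf.continuous.comp (by fun_prop)).aestronglyMeasurable)
    (integrableOn_fundDomain hA (hf.continuous.comp (by fun_prop)))
    ((hcd.comp (by fun_prop : Continuous fun x : E n => x + (0:ℝ) • v)).aestronglyMeasurable)
    (Eventually.of_forall fun x s _ => hC _)
    (integrable_const C)
    (Eventually.of_forall fun x s _ => by
      have h1 := ((hf.differentiable one_ne_zero) (x + s • v)).hasFDerivAt
      have h2 : HasDerivAt (fun s : ℝ => x + s • v) v s := by
        simpa using ((hasDerivAt_id s).smul_const v).const_add x
      exact h1.comp_hasDerivAt s h2)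
  have h2 := key.2
  simp only [integral_fundDomain_add hA hp, zero_smul, add_zero] at h2
  exact h2.unique (hasDerivAt_const _ _)

end Lattice

section Parseval

/-- The half-open unit cube `(0,1]ⁿ`. -/
def unitCube (n : ℕ) : Set (Fin n → ℝ) := {y | ∀ i, y i ∈ Set.Ioc (0 : ℝ) (0 + 1)}

lemma integral_fundDomain_eq_unitCube {n : ℕ} {A : Matrix (Fin n) (Fin n) ℝ} (hA : IsUnit A.det)
    {V : Type*} [NormedAddCommGroup V] [NormedSpace ℝ V] (f : E n → V) :
    ∫ x in fundDomain A, f x = |A.det| • ∫ y in unitCube n, f (matVec A y) := by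
  have hemb : MeasurableEmbedding (WithLp.toLp 2 : (Fin n → ℝ) → E n) :=
    (MeasurableEquiv.toLp 2 (Fin n → ℝ)).measurableEmbedding
  rw [← (PiLp.volume_preserving_toLp (Fin n)).setIntegral_preimage_emb hemb]
  have hset : (WithLp.toLp 2 : (Fin n → ℝ) → E n) ⁻¹' fundDomain A =
      (A.mulVecLin.toContinuousLinearMap) '' (Set.univ.pi fun _ => Set.Ico (0 : ℝ) 1) := by
    ext y
    constructor
    · rintro ⟨t, ht, h⟩
      refine ⟨t, fun i _ => ht i, ?_⟩
      exact (WithLp.toLp_injective 2 h).symm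
    · rintro ⟨t, ht, rfl⟩
      exact ⟨t, fun i => ht i trivial, rfl⟩
  have hinj : Function.Injective A.mulVecLin.toContinuousLinearMap :=
    Matrix.mulVec_injective_of_isUnit ((Matrix.isUnit_iff_isUnit_det A).2 hA)
  rw [hset, integral_image_eq_integral_abs_det_fderiv_smul volume
    (MeasurableSet.univ_pi fun _ => measurableSet_Ico)
    (fun x _ => (A.mulVecLin.toContinuousLinearMap).hasFDerivAt.hasFDerivWithinAt)
    hinj.injOn]
  have hdet : (A.mulVecLin.toContinuousLinearMap).det = A.det := by
    rw [ContinuousLinearMap.det]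
    exact LinearMap.det_toLin' A
  rw [integral_smul, hdet]
  congr 1
  have hcube : unitCube n = Set.univ.pi fun _ => Set.Ioc (0 : ℝ) 1 := by
    ext y; simp [unitCube]
  rw [hcube]
  exact setIntegral_congr_set
    (Measure.univ_pi_Ico_ae_eq_Icc.trans Measure.univ_pi_Ioc_ae_eq_Icc.symm)

/-- The normalized Haar measure on the unit circle. -/
local instance unitCircleMeasureSpace : MeasureSpace UnitAddCircle := ⟨AddCircle.haarAddCircle⟩

local instance unitCircleHaar : Measure.IsAddHaarMeasure (volume : Measure UnitAddCircle) :=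
  inferInstanceAs (Measure.IsAddHaarMeasure AddCircle.haarAddCircle)

local instance unitCircleProb : IsProbabilityMeasure (volume : Measure UnitAddCircle) :=
  inferInstanceAs (IsProbabilityMeasure AddCircle.haarAddCircle)

lemma mFourier_coe {n : ℕ} (k : Fin n → ℤ) (y : Fin n → ℝ) :
    UnitAddTorus.mFourier k (fun i => (y i : UnitAddCircle)) =
      Complex.exp (2 * π * Complex.I * ((∑ i, (k i : ℝ) * y i : ℝ) : ℂ)) := by
  simp only [UnitAddTorus.mFourier, ContinuousMap.coe_mk, fourier_coe_apply]
  rw [← Complex.exp_sum]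
  congr 1
  push_cast
  rw [Finset.mul_sum]
  exact Finset.sum_congr rfl fun i _ => by ring

/-- Parseval's identity on the unit cube. -/
lemma hasSum_sq_norm_integral_unitCube {n : ℕ} {g : (Fin n → ℝ) → ℂ} (hg : Continuous g) :
    HasSum (fun k : Fin n → ℤ => ‖∫ y in unitCube n,
        Complex.exp (-(2 * π * Complex.I * ((∑ i, (k i : ℝ) * y i : ℝ) : ℂ))) * g y‖ ^ 2)
      (∫ y in unitCube n, ‖g y‖ ^ 2) := by
  set G : UnitAddTorus (Fin n) → ℂ :=
    fun x => g (UnitAddTorus.measurableEquivPiIoc (fun _ => 0) x).1 with hG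
  have hGy : ∀ y ∈ unitCube n, G (fun i => (y i : UnitAddCircle)) = g y := by
    intro y hy
    have := (UnitAddTorus.measurableEquivPiIoc (fun _ : Fin n => (0:ℝ))).apply_symm_apply ⟨y, hy⟩
    rw [UnitAddTorus.coe_symm_measurableEquivPiIoc_apply] at this
    simp only [hG]
    rw [this]
  have hmeasG : Measurable G := hg.measurable.comp
    (measurable_subtype_coe.comp (UnitAddTorus.measurableEquivPiIoc _).measurable)
  have hcubeM : MeasurableSet (unitCube n) :=
    MeasurableSet.univ_pi' (fun _ => measurableSet_Ioc)
  obtain ⟨C, hC⟩ := (isCompact_univ_pi fun _ : Fin n =>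
    isCompact_Icc (a := (0:ℝ)) (b := 1)).exists_bound_of_continuousOn hg.continuousOn
  have hLp : MemLp G 2 volume := by
    refine MemLp.of_bound hmeasG.aestronglyMeasurable C (Eventually.of_forall fun x => hC _ ?_)
    intro i _
    have := (UnitAddTorus.measurableEquivPiIoc (fun _ => 0) x).2 i
    exact ⟨this.1.le, by simpa using this.2⟩
  have h := UnitAddTorus.hasSum_sq_mFourierCoeff (hLp.toLp G)
  have hcoef : ∀ k : Fin n → ℤ, UnitAddTorus.mFourierCoeff (hLp.toLp G) k =
      ∫ y in unitCube n,
        Complex.exp (-(2 * π * Complex.I * ((∑ i, (k i : ℝ) * y i : ℝ) : ℂ))) * g y := by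
    intro k
    have h1 : UnitAddTorus.mFourierCoeff (hLp.toLp G) k = UnitAddTorus.mFourierCoeff G k := by
      refine integral_congr_ae ?_
      filter_upwards [hLp.coeFn_toLp] with x hx
      rw [hx]
    rw [h1, UnitAddTorus.mFourierCoeff_eq_integral _ _ (fun _ => 0)]
    refine setIntegral_congr_fun hcubeM fun y hy => ?_
    rw [hGy y hy, mFourier_coe, smul_eq_mul]
    congr 2
    simp
  have hnorm : ∫ x, ‖(hLp.toLp G : UnitAddTorus (Fin n) → ℂ) x‖ ^ 2 =
      ∫ y in unitCube n, ‖g y‖ ^ 2 := by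
    have h1 : ∫ x, ‖(hLp.toLp G : UnitAddTorus (Fin n) → ℂ) x‖ ^ 2 = ∫ x, ‖G x‖ ^ 2 := by
      refine integral_congr_ae ?_
      filter_upwards [hLp.coeFn_toLp] with x hx
      rw [hx]
    rw [h1, UnitAddTorus.integral_preimage _ (fun _ => 0)]
    refine setIntegral_congr_fun hcubeM fun y hy => ?_
    rw [hGy y hy]
  simp only [hcoef] at h
  rwa [hnorm] at h

end Parseval

section Frequencies

variable {n : ℕ} {A : Matrix (Fin n) (Fin n) ℝ}

/-- The dual lattice vector `A⁻ᵀ·k` attached to `k ∈ ℤⁿ`. -/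
def dualFreq (A : Matrix (Fin n) (Fin n) ℝ) (k : Fin n → ℤ) : E n :=
  WithLp.toLp 2 (A⁻¹.transpose.mulVec fun i => (k i : ℝ))

lemma inner_matVec (w : E n) (y : Fin n → ℝ) :
    ⟪w, matVec A y⟫_ℝ = (A.transpose.mulVec w.ofLp) ⬝ᵥ y := by
  rw [EuclideanSpace.inner_eq_star_dotProduct]
  simp [matVec, Matrix.mulVec_transpose, Matrix.dotProduct_mulVec, dotProduct_comm]

lemma inner_dualFreq_matVec (hA : IsUnit A.det) (k : Fin n → ℤ) (y : Fin n → ℝ) :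
    ⟪dualFreq A k, matVec A y⟫_ℝ = ∑ i, (k i : ℝ) * y i := by
  rw [inner_matVec, dualFreq, Matrix.mulVec_mulVec, ← Matrix.transpose_mul,
    Matrix.nonsing_inv_mul A hA, Matrix.transpose_one, Matrix.one_mulVec]
  rfl

lemma dualFreq_mem (hA : IsUnit A.det) (k : Fin n → ℤ) :
    dualFreq A k ∈ dualLattice (lattice A) := by
  rintro x ⟨m, rfl⟩
  exact ⟨∑ i, k i * m i, by rw [inner_dualFreq_matVec hA]; push_cast; rfl⟩

lemma finite_norm_dualFreq_le (hA : IsUnit A.det) (R : ℝ) :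
    {k : Fin n → ℤ | ‖dualFreq A k‖ ≤ R}.Finite := by
  set b : Fin n → ℤ := fun i => ⌈R * ‖matVec A (Pi.single i 1)‖⌉ with hb
  refine (Set.finite_Icc (-b) b).subset fun k hk => ?_
  have h : ∀ i, |(k i : ℝ)| ≤ b i := fun i => by
    have h1 := inner_dualFreq_matVec hA k (Pi.single i 1)
    simp only [Pi.single_apply, mul_ite, mul_one, mul_zero, Finset.sum_ite_eq',
      Finset.mem_univ, if_true] at h1
    rw [← h1]
    refine (abs_real_inner_le_norm _ _).trans (le_trans ?_ (Int.le_ceil _))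
    exact mul_le_mul_of_nonneg_right hk (norm_nonneg _)
  constructor
  · intro i
    have := (abs_le.1 (h i)).1
    simp only [Pi.neg_apply]
    exact_mod_cast this
  · intro i
    have := (abs_le.1 (h i)).2
    exact_mod_cast this

/-- Under the gap condition, all further dual frequencies are uniformly longer than `w`. -/
lemma exists_spectral_gap (hA : IsUnit A.det) {w : E n} (hgap : GapCondition (lattice A) w) :
    ∃ ν > 4 * π ^ 2 * ‖w‖ ^ 2, ∀ k : Fin n → ℤ, dualFreq A k ≠ 0 → dualFreq A k ≠ w →
      dualFreq A k ≠ -w → ν ≤ 4 * π ^ 2 * ‖dualFreq A k‖ ^ 2 := by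
  obtain ⟨-, -, hlt⟩ := hgap
  set S : Set (Fin n → ℤ) := {k | ‖dualFreq A k‖ ≤ ‖w‖ + 1} ∩
    {k | dualFreq A k ≠ 0 ∧ dualFreq A k ≠ w ∧ dualFreq A k ≠ -w} with hS
  have hfin : S.Finite := (finite_norm_dualFreq_le hA _).inter_of_left _
  obtain ⟨r, hr, hrS⟩ : ∃ r > ‖w‖, ∀ k ∈ S, r ≤ ‖dualFreq A k‖ := by
    rcases S.eq_empty_or_nonempty with h | h
    · exact ⟨‖w‖ + 1, by linarith, by simp [h]⟩
    · obtain ⟨k, hk, hmin⟩ := hfin.exists_minimalFor (fun k => ‖dualFreq A k‖) S h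
      refine ⟨_, hlt _ (dualFreq_mem hA k) hk.2.1 hk.2.2.1 hk.2.2.2, fun j hj => ?_⟩
      by_contra! hcon
      exact absurd (hmin hj hcon.le) (not_le.2 hcon)
  have hr' : ‖w‖ < min r (‖w‖ + 1) := lt_min hr (by linarith)
  refine ⟨4 * π ^ 2 * (min r (‖w‖ + 1)) ^ 2, ?_, fun k h0 h1 h2 => ?_⟩
  · have := norm_nonneg w
    gcongr
  · have hpos : 0 ≤ min r (‖w‖ + 1) := (norm_nonneg w).trans hr'.le
    have h : min r (‖w‖ + 1) ≤ ‖dualFreq A k‖ := by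
      by_cases hk : ‖dualFreq A k‖ ≤ ‖w‖ + 1
      · exact (min_le_left _ _).trans (hrS k ⟨hk, h0, h1, h2⟩)
      · exact (min_le_right _ _).trans (not_le.1 hk).le
    gcongr

/-- The exponential `x ↦ e^{-2πi⟨v,x⟩}`. -/
def expFreq (v : E n) (x : E n) : ℂ := Complex.exp (-(2 * π * Complex.I * ((⟪v, x⟫_ℝ : ℝ) : ℂ)))

lemma hasFDerivAt_expFreq (v x : E n) : HasFDerivAt (expFreq v)
    ((-(2 * π * Complex.I) * expFreq v x) •
      (Complex.ofRealCLM.comp (innerSL ℝ v) : E n →L[ℝ] ℂ)) x := by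
  have h1 : HasFDerivAt (fun x : E n => ((⟪v, x⟫_ℝ : ℝ) : ℂ))
      (Complex.ofRealCLM.comp (innerSL ℝ v) : E n →L[ℝ] ℂ) x :=
    (Complex.ofRealCLM.comp (innerSL ℝ v) : E n →L[ℝ] ℂ).hasFDerivAt
  have h2 := ((h1.const_mul (2 * π * Complex.I)).neg).cexp
  refine h2.congr_fderiv ?_
  ext u
  simp [expFreq]
  ring

lemma contDiff_expFreq (v : E n) : ContDiff ℝ 1 (expFreq v) := by
  have h1 : ContDiff ℝ 1 (fun x : E n => ((⟪v, x⟫_ℝ : ℝ) : ℂ)) :=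
    (Complex.ofRealCLM.comp (innerSL ℝ v) : E n →L[ℝ] ℂ).contDiff
  exact ((contDiff_const.mul h1).neg).cexp

lemma periodic_expFreq {v : E n} (hv : v ∈ dualLattice (lattice A)) :
    ∀ x, ∀ γ ∈ lattice A, expFreq v (x + γ) = expFreq v x := by
  intro x γ hγ
  obtain ⟨k, hk⟩ := hv γ hγ
  rw [expFreq, expFreq, Complex.exp_eq_exp_iff_exists_int]
  refine ⟨-k, ?_⟩
  rw [inner_add_right, hk]
  push_cast
  ring

/-- Integration by parts against an exponential. -/
lemma integral_expFreq_fderiv (hA : IsUnit A.det) {v : E n} (hv : v ∈ dualLattice (lattice A))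
    {f : E n → ℝ} (hf : ContDiff ℝ 1 f) (hp : IsPeriodic (lattice A) f) (u : E n) :
    ∫ x in fundDomain A, expFreq v x * (fderiv ℝ f x u : ℂ) =
      2 * π * Complex.I * (⟪v, u⟫_ℝ : ℝ) * ∫ x in fundDomain A, expFreq v x * (f x : ℂ) := by
  have hfc : ContDiff ℝ 1 (fun x => (f x : ℂ)) := Complex.ofRealCLM.contDiff.comp hf
  have h0 := integral_fderiv_eq_zero hA ((contDiff_expFreq v).mul hfc)
    (fun x γ hγ => by rw [periodic_expFreq hv x γ hγ, hp x γ hγ]) u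
  have hd : ∀ x, fderiv ℝ (fun x => expFreq v x * (f x : ℂ)) x u =
      expFreq v x * (fderiv ℝ f x u : ℂ) -
        2 * π * Complex.I * (⟪v, u⟫_ℝ : ℝ) * (expFreq v x * (f x : ℂ)) := by
    intro x
    have h1 : HasFDerivAt (fun x => (f x : ℂ)) (Complex.ofRealCLM.comp (fderiv ℝ f x)) x :=
      Complex.ofRealCLM.hasFDerivAt.comp x (hf.differentiable one_ne_zero x).hasFDerivAt
    have h2 : HasFDerivAt (fun x => expFreq v x * (f x : ℂ)) _ x :=
      (hasFDerivAt_expFreq v x).mul h1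
    rw [h2.fderiv]
    simp
    ring
  have hc1 : Continuous fun x => expFreq v x * (fderiv ℝ f x u : ℂ) :=
    (contDiff_expFreq v).continuous.mul (Complex.continuous_ofReal.comp
      ((hf.continuous_fderiv one_ne_zero).clm_apply continuous_const))
  have hc2 : Continuous fun x => expFreq v x * (f x : ℂ) :=
    (contDiff_expFreq v).continuous.mul hfc.continuous
  simp only [hd] at h0
  rw [integral_sub (integrableOn_fundDomain hA hc1)
    ((integrableOn_fundDomain hA hc2).const_mul _), integral_const_mul] at h0
  exact sub_eq_zero.1 h0

lemma HasSum.congr_val {ι : Type*} {f : ι → ℝ} {a b : ℝ} (h : HasSum f a) (hab : b = a) :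
    HasSum f b := hab ▸ h

/-- Parseval's identity on the fundamental domain. -/
lemma hasSum_sq_norm_integral_expFreq (hA : IsUnit A.det) {f : E n → ℝ} (hf : Continuous f) :
    HasSum (fun k : Fin n → ℤ =>
        ‖∫ x in fundDomain A, expFreq (dualFreq A k) x * (f x : ℂ)‖ ^ 2)
      (|A.det| * ∫ x in fundDomain A, f x ^ 2) := by
  have hcont : Continuous fun y => matVec A y := (matEquiv A hA).toLinearMap.continuous_of_finiteDimensional
  have h := (hasSum_sq_norm_integral_unitCube
    (Complex.continuous_ofReal.comp (hf.comp hcont))).mul_left (|A.det| ^ 2)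
  refine (h.congr_fun fun k => ?_).congr_val ?_
  · rw [integral_fundDomain_eq_unitCube hA, norm_smul, mul_pow, norm_abs_eq_norm,
      Real.norm_eq_abs]
    simp only [expFreq, inner_dualFreq_matVec hA]
    rfl
  · rw [integral_fundDomain_eq_unitCube hA]
    simp only [Function.comp_apply, Complex.norm_real, norm_eq_abs, sq_abs, smul_eq_mul]
    rw [← sq_abs A.det, sq, mul_assoc]

lemma norm_sq_gradient (f : E n → ℝ) (x : E n) :
    ‖gradient f x‖ ^ 2 = ∑ i, (fderiv ℝ f x (EuclideanSpace.single i 1)) ^ 2 := by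
  rw [EuclideanSpace.real_norm_sq_eq]
  refine Finset.sum_congr rfl fun i _ => ?_
  rw [← inner_gradient_left, EuclideanSpace.inner_single_right]
  simp

lemma continuous_gradient {f : E n → ℝ} (hf : ContDiff ℝ 1 f) : Continuous (gradient f) :=
  (InnerProductSpace.toDual ℝ (E n)).symm.continuous.comp (hf.continuous_fderiv one_ne_zero)

lemma hasSum_sq_norm_gradient (hA : IsUnit A.det) {f : E n → ℝ} (hf : ContDiff ℝ 1 f)
    (hp : IsPeriodic (lattice A) f) :
    HasSum (fun k : Fin n → ℤ => 4 * π ^ 2 * ‖dualFreq A k‖ ^ 2 *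
        ‖∫ x in fundDomain A, expFreq (dualFreq A k) x * (f x : ℂ)‖ ^ 2)
      (|A.det| * ∫ x in fundDomain A, ‖gradient f x‖ ^ 2) := by
  have hc : ∀ i : Fin n, Continuous fun x => fderiv ℝ f x (EuclideanSpace.single i 1) :=
    fun i => (hf.continuous_fderiv one_ne_zero).clm_apply continuous_const
  have h := hasSum_sum (s := Finset.univ)
    fun (i : Fin n) _ => hasSum_sq_norm_integral_expFreq hA (hc i)
  refine (h.congr_fun fun k => ?_).congr_val ?_
  · simp only [integral_expFreq_fderiv hA (dualFreq_mem hA k) hf hp, norm_mul, mul_pow]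
    rw [← Finset.sum_mul, EuclideanSpace.real_norm_sq_eq, Finset.mul_sum]
    congr 1
    refine Finset.sum_congr rfl fun i _ => ?_
    rw [EuclideanSpace.inner_single_right]
    simp only [Complex.norm_ofNat, Complex.norm_real, Complex.norm_I, Real.norm_eq_abs, sq_abs,
      conj_trivial, one_mul, one_pow, mul_one]
    ring
  · rw [← Finset.mul_sum, ← integral_finsetSum]
    · simp only [norm_sq_gradient]
    · exact fun i _ => integrableOn_fundDomain hA ((hc i).pow 2)

/-- The Poincaré inequality on the orthogonal complement of the first eigenspace. -/
lemma poincare_of_orthogonal (hA : IsUnit A.det) {w : E n} {ν : ℝ}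
    (hν : ∀ k : Fin n → ℤ, dualFreq A k ≠ 0 → dualFreq A k ≠ w →
      dualFreq A k ≠ -w → ν ≤ 4 * π ^ 2 * ‖dualFreq A k‖ ^ 2)
    {f : E n → ℝ} (hf : ContDiff ℝ 1 f) (hp : IsPeriodic (lattice A) f)
    (h0 : ∫ x in fundDomain A, f x = 0)
    (hs : ∫ x in fundDomain A, f x * Real.sin (2 * π * ⟪w, x⟫_ℝ) = 0)
    (hc : ∫ x in fundDomain A, f x * Real.cos (2 * π * ⟪w, x⟫_ℝ) = 0) :
    ν * ∫ x in fundDomain A, f x ^ 2 ≤ ∫ x in fundDomain A, ‖gradient f x‖ ^ 2 := by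
  have hD : 0 < |A.det| := abs_pos.2 hA.ne_zero
  have h1 := (hasSum_sq_norm_integral_expFreq hA hf.continuous).mul_left ν
  have h2 := hasSum_sq_norm_gradient hA hf hp
  have hsc : Continuous fun x : E n => f x * Real.sin (2 * π * ⟪w, x⟫_ℝ) :=
    hf.continuous.mul (by fun_prop)
  have hcc : Continuous fun x : E n => f x * Real.cos (2 * π * ⟪w, x⟫_ℝ) :=
    hf.continuous.mul (by fun_prop)
  have hw : ∀ s : ℝ, (s = 1 ∨ s = -1) →
      ∫ x in fundDomain A, expFreq (s • w) x * (f x : ℂ) = 0 := by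
    intro s hs1
    have he : ∀ x, expFreq (s • w) x * (f x : ℂ) =
        ((f x * Real.cos (2 * π * ⟪w, x⟫_ℝ) : ℝ) : ℂ) -
          s * Complex.I * ((f x * Real.sin (2 * π * ⟪w, x⟫_ℝ) : ℝ) : ℂ) := by
      intro x
      have : expFreq (s • w) x =
          Complex.exp (((-(s * (2 * π * ⟪w, x⟫_ℝ)) : ℝ) : ℂ) * Complex.I) := by
        rw [expFreq, real_inner_smul_left]
        congr 1
        push_cast
        ring
      rw [this, Complex.exp_mul_I, ← Complex.ofReal_cos, ← Complex.ofReal_sin]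
      rcases hs1 with rfl | rfl
      · rw [one_mul, Real.cos_neg, Real.sin_neg]; push_cast; ring
      · rw [neg_one_mul, neg_neg]; push_cast; ring
    simp only [he]
    rw [integral_sub, integral_const_mul, integral_complex_ofReal, integral_complex_ofReal, hs, hc]
    · simp
    · exact integrableOn_fundDomain hA (Complex.continuous_ofReal.comp hcc)
    · exact (integrableOn_fundDomain hA (Complex.continuous_ofReal.comp hsc)).const_mul _
  have hle := hasSum_le (fun k => ?_) h1 h2
  · refine le_of_mul_le_mul_left ?_ hD
    linarith
  · by_cases k0 : dualFreq A k = 0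
    · have : ∫ x in fundDomain A, expFreq (dualFreq A k) x * (f x : ℂ) = 0 := by
        simp only [k0, expFreq, inner_zero_left, Complex.ofReal_zero, mul_zero, neg_zero,
          Complex.exp_zero, one_mul]
        rw [integral_complex_ofReal, h0, Complex.ofReal_zero]
      simp [this]
    by_cases k1 : dualFreq A k = w
    · have := hw 1 (Or.inl rfl)
      rw [one_smul] at this
      simp [k1, this]
    by_cases k2 : dualFreq A k = -w
    · have := hw (-1) (Or.inr rfl)
      rw [neg_one_smul] at this
      simp [k2, this]
    exact mul_le_mul_of_nonneg_right (hν k k0 k1 k2) (sq_nonneg _)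

end Frequencies

section Perturbation

lemma abs_norm_add_sq_mul_exp_sub_le {V : Type*} [NormedAddCommGroup V] [InnerProductSpace ℝ V]
    (a b : V) {s σ η : ℝ} (hs : |s| ≤ σ) (hσ : σ ≤ 1) (hη : 0 < η) :
    |‖a + b‖ ^ 2 * Real.exp s - (‖a‖ ^ 2 + s * ‖a‖ ^ 2 + 2 * ⟪a, b⟫_ℝ + ‖b‖ ^ 2)| ≤
      σ ^ 2 * (1 + 4 / η) * ‖a‖ ^ 2 + (η + 2 * σ) * ‖b‖ ^ 2 := by
  have hσ0 : 0 ≤ σ := (abs_nonneg s).trans hs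
  obtain ⟨r, hr⟩ : ∃ r, r = Real.exp s - 1 - s := ⟨_, rfl⟩
  have hr1 : |r| ≤ σ ^ 2 := by
    rw [hr]
    refine (Real.abs_exp_sub_one_sub_id_le (hs.trans hσ)).trans ?_
    rw [← sq_abs s]
    gcongr
  have hsr : |s + r| ≤ 2 * σ := by
    refine (abs_add_le _ _).trans ?_
    nlinarith
  have hc := abs_real_inner_le_norm a b
  have he : Real.exp s = 1 + s + r := by rw [hr]; ring
  rw [norm_add_sq_real, he]
  have hsplit : (‖a‖ ^ 2 + 2 * ⟪a, b⟫_ℝ + ‖b‖ ^ 2) * (1 + s + r) -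
      (‖a‖ ^ 2 + s * ‖a‖ ^ 2 + 2 * ⟪a, b⟫_ℝ + ‖b‖ ^ 2) =
      r * ‖a‖ ^ 2 + 2 * (⟪a, b⟫_ℝ * (s + r)) + (s + r) * ‖b‖ ^ 2 := by ring
  rw [hsplit]
  have h1 : |r * ‖a‖ ^ 2| ≤ σ ^ 2 * ‖a‖ ^ 2 := by
    rw [abs_mul, abs_of_nonneg (sq_nonneg ‖a‖)]
    gcongr
  have h3 : |(s + r) * ‖b‖ ^ 2| ≤ 2 * σ * ‖b‖ ^ 2 := by
    rw [abs_mul, abs_of_nonneg (sq_nonneg ‖b‖)]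
    gcongr
  have h2 : |2 * (⟪a, b⟫_ℝ * (s + r))| ≤ 4 * σ ^ 2 / η * ‖a‖ ^ 2 + η * ‖b‖ ^ 2 := by
    rw [abs_mul, abs_mul, abs_two]
    have h4 : |⟪a, b⟫_ℝ| * |s + r| ≤ ‖a‖ * ‖b‖ * (2 * σ) := by gcongr
    have h5 : 4 * σ ^ 2 / η * ‖a‖ ^ 2 + η * ‖b‖ ^ 2 - 4 * σ * ‖a‖ * ‖b‖ =
        (2 * σ * ‖a‖ - η * ‖b‖) ^ 2 / η := by
      field_simp
      ring
    have h6 : 0 ≤ (2 * σ * ‖a‖ - η * ‖b‖) ^ 2 / η := by positivity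
    linarith
  calc _ ≤ |r * ‖a‖ ^ 2| + |2 * (⟪a, b⟫_ℝ * (s + r))| + |(s + r) * ‖b‖ ^ 2| := abs_add_three _ _ _
    _ ≤ σ ^ 2 * ‖a‖ ^ 2 + (4 * σ ^ 2 / η * ‖a‖ ^ 2 + η * ‖b‖ ^ 2) + 2 * σ * ‖b‖ ^ 2 := by gcongr
    _ = _ := by ring

/-- Second-order control of a weighted square integral when the weight is orthogonal to `‖X‖²`. -/
lemma abs_integral_norm_add_sq_mul_exp_sub_le {n : ℕ} {A : Matrix (Fin n) (Fin n) ℝ}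
    (hA : IsUnit A.det) {V : Type*} [NormedAddCommGroup V] [InnerProductSpace ℝ V]
    {X Y : E n → V} (hX : Continuous X) (hY : Continuous Y) {φ : E n → ℝ} (hφ : Continuous φ)
    {c σ η : ℝ} (hs : ∀ x, |c * φ x| ≤ σ) (hσ : σ ≤ 1) (hη : 0 < η)
    (hφX : ∫ x in fundDomain A, φ x * ‖X x‖ ^ 2 = 0)
    (hXY : ∫ x in fundDomain A, ⟪X x, Y x⟫_ℝ = 0) :
    |(∫ x in fundDomain A, ‖X x + Y x‖ ^ 2 * Real.exp (c * φ x)) -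
        ((∫ x in fundDomain A, ‖X x‖ ^ 2) + ∫ x in fundDomain A, ‖Y x‖ ^ 2)| ≤
      σ ^ 2 * (1 + 4 / η) * (∫ x in fundDomain A, ‖X x‖ ^ 2) +
        (η + 2 * σ) * ∫ x in fundDomain A, ‖Y x‖ ^ 2 := by
  have i0 : IntegrableOn (fun x => ‖X x + Y x‖ ^ 2 * Real.exp (c * φ x)) (fundDomain A) :=
    integrableOn_fundDomain hA (by fun_prop)
  have i1 : IntegrableOn (fun x => ‖X x‖ ^ 2) (fundDomain A) :=
    integrableOn_fundDomain hA (by fun_prop)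
  have i2 : IntegrableOn (fun x => c * φ x * ‖X x‖ ^ 2) (fundDomain A) :=
    integrableOn_fundDomain hA (by fun_prop)
  have i3 : IntegrableOn (fun x => 2 * ⟪X x, Y x⟫_ℝ) (fundDomain A) :=
    integrableOn_fundDomain hA (by fun_prop)
  have i4 : IntegrableOn (fun x => ‖Y x‖ ^ 2) (fundDomain A) :=
    integrableOn_fundDomain hA (by fun_prop)
  have i12 : IntegrableOn (fun x => ‖X x‖ ^ 2 + c * φ x * ‖X x‖ ^ 2) (fundDomain A) := i1.add i2
  have i123 : IntegrableOn (fun x => ‖X x‖ ^ 2 + c * φ x * ‖X x‖ ^ 2 + 2 * ⟪X x, Y x⟫_ℝ)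
      (fundDomain A) := i12.add i3
  have i1234 : IntegrableOn
      (fun x => ‖X x‖ ^ 2 + c * φ x * ‖X x‖ ^ 2 + 2 * ⟪X x, Y x⟫_ℝ + ‖Y x‖ ^ 2)
      (fundDomain A) := i123.add i4
  have hlin : ∫ x in fundDomain A,
      (‖X x‖ ^ 2 + c * φ x * ‖X x‖ ^ 2 + 2 * ⟪X x, Y x⟫_ℝ + ‖Y x‖ ^ 2) =
      (∫ x in fundDomain A, ‖X x‖ ^ 2) + ∫ x in fundDomain A, ‖Y x‖ ^ 2 := by
    rw [integral_add i123 i4, integral_add i12 i3, integral_add i1 i2,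
      integral_const_mul, hXY]
    simp only [mul_assoc]
    rw [integral_const_mul, hφX]
    ring
  rw [← hlin, ← integral_sub i0 i1234, ← integral_const_mul,
    ← integral_const_mul, ← integral_add (i1.const_mul _) (i4.const_mul _)]
  refine abs_integral_le_integral_abs.trans (integral_mono ?_ ?_ fun x => ?_)
  · exact (i0.sub i1234).abs
  · exact (i1.const_mul _).add (i4.const_mul _)
  · exact abs_norm_add_sq_mul_exp_sub_le _ _ (hs x) hσ hη

end Perturbation

section Trigonometric

variable {n : ℕ} {A : Matrix (Fin n) (Fin n) ℝ}

/-- The function `a·sin(2π⟨w,x⟩) + b·cos(2π⟨w,x⟩)`. -/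
def trigFun (w : E n) (a b : ℝ) (x : E n) : ℝ :=
  a * Real.sin (2 * π * ⟪w, x⟫_ℝ) + b * Real.cos (2 * π * ⟪w, x⟫_ℝ)

lemma contDiff_trigFun (w : E n) (a b : ℝ) {m : WithTop ℕ∞} : ContDiff ℝ m (trigFun w a b) := by
  have h : ContDiff ℝ m fun x : E n => 2 * π * ⟪w, x⟫_ℝ :=
    contDiff_const.mul (innerSL ℝ w).contDiff
  exact (contDiff_const.mul h.sin).add (contDiff_const.mul h.cos)

lemma periodic_trigFun {w : E n} (hw : w ∈ dualLattice (lattice A)) (a b : ℝ) :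
    IsPeriodic (lattice A) (trigFun w a b) := by
  intro x γ hγ
  obtain ⟨k, hk⟩ := hw γ hγ
  have : 2 * π * ⟪w, x + γ⟫_ℝ = 2 * π * ⟪w, x⟫_ℝ + k * (2 * π) := by
    rw [inner_add_right, hk]; ring
  rw [trigFun, trigFun, this, Real.sin_add_int_mul_two_pi, Real.cos_add_int_mul_two_pi]

lemma fderiv_trigFun (w : E n) (a b : ℝ) (x u : E n) :
    fderiv ℝ (trigFun w a b) x u = 2 * π * trigFun w (-b) a x * ⟪w, u⟫_ℝ := by
  have h1 : HasFDerivAt (fun x : E n => 2 * π * ⟪w, x⟫_ℝ) ((2 * π) • innerSL ℝ w) x :=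
    (innerSL ℝ w).hasFDerivAt.const_mul (2 * π)
  have h2 : HasFDerivAt (trigFun w a b) _ x := (h1.sin.const_mul a).add (h1.cos.const_mul b)
  rw [h2.fderiv]
  simp [trigFun]
  ring

lemma gradient_trigFun (w : E n) (a b : ℝ) (x : E n) :
    gradient (trigFun w a b) x = (2 * π * trigFun w (-b) a x) • w := by
  refine ext_inner_right ℝ fun u => ?_
  rw [inner_gradient_left, fderiv_trigFun, real_inner_smul_left]

lemma norm_sq_gradient_trigFun (w : E n) (a b : ℝ) (x : E n) :
    ‖gradient (trigFun w a b) x‖ ^ 2 = 4 * π ^ 2 * ‖w‖ ^ 2 * trigFun w (-b) a x ^ 2 := by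
  rw [gradient_trigFun, norm_smul, mul_pow, Real.norm_eq_abs, sq_abs]
  ring

lemma trigFun_sq (w : E n) (a b : ℝ) (x : E n) :
    trigFun w a b x ^ 2 =
      (a ^ 2 + b ^ 2) / 2 + trigFun ((2 : ℝ) • w) (a * b) ((b ^ 2 - a ^ 2) / 2) x := by
  have : 2 * π * ⟪(2 : ℝ) • w, x⟫_ℝ = 2 * (2 * π * ⟪w, x⟫_ℝ) := by
    rw [real_inner_smul_left]; ring
  rw [trigFun, trigFun, this, Real.sin_two_mul, Real.cos_two_mul']
  linear_combination ((a ^ 2 + b ^ 2) / 2) * Real.sin_sq_add_cos_sq (2 * π * ⟪w, x⟫_ℝ)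

lemma integral_one_fundDomain (hA : IsUnit A.det) : ∫ _ in fundDomain A, (1 : ℝ) = |A.det| := by
  rw [integral_fundDomain_eq_unitCube hA]
  have hcube : unitCube n = Set.univ.pi fun _ => Set.Ioc (0 : ℝ) 1 := by
    ext y; simp [unitCube]
  simp [hcube, measureReal_def, Real.volume_pi_Ioc]

lemma integral_trigFun (hA : IsUnit A.det) {w : E n} (hw : w ∈ dualLattice (lattice A))
    (hw0 : w ≠ 0) (a b : ℝ) : ∫ x in fundDomain A, trigFun w a b x = 0 := by
  have h := integral_fderiv_eq_zero hA (contDiff_trigFun w b (-a)) (periodic_trigFun hw b (-a)) w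
  simp only [fderiv_trigFun, neg_neg, real_inner_self_eq_norm_sq] at h
  rw [integral_mul_const, integral_const_mul] at h
  simpa [pi_ne_zero, hw0] using h

lemma integral_trigFun_sq (hA : IsUnit A.det) {w : E n} (hw : w ∈ dualLattice (lattice A))
    (hw0 : w ≠ 0) (a b : ℝ) :
    ∫ x in fundDomain A, trigFun w a b x ^ 2 = (a ^ 2 + b ^ 2) / 2 * |A.det| := by
  have hw2 : (2 : ℝ) • w ∈ dualLattice (lattice A) := by
    intro x hx
    obtain ⟨k, hk⟩ := hw x hx
    exact ⟨2 * k, by rw [real_inner_smul_left, hk]; push_cast; ring⟩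
  simp only [trigFun_sq]
  rw [integral_add (integrableOn_fundDomain hA continuous_const)
    (integrableOn_fundDomain hA (contDiff_trigFun (m := 0) _ _ _).continuous),
    integral_trigFun hA hw2 (by simpa using hw0), ← integral_one_fundDomain hA,
    ← integral_const_mul]
  simp

lemma integral_norm_sq_gradient_trigFun (hA : IsUnit A.det) {w : E n}
    (hw : w ∈ dualLattice (lattice A)) (hw0 : w ≠ 0) (a b : ℝ) :
    ∫ x in fundDomain A, ‖gradient (trigFun w a b) x‖ ^ 2 =
      4 * π ^ 2 * ‖w‖ ^ 2 * ∫ x in fundDomain A, trigFun w a b x ^ 2 := by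
  simp only [norm_sq_gradient_trigFun]
  rw [integral_const_mul, integral_trigFun_sq hA hw hw0, integral_trigFun_sq hA hw hw0]
  ring

lemma integral_mul_trigFun (hA : IsUnit A.det) {w : E n} {f : E n → ℝ} (hf : Continuous f)
    (a b : ℝ) :
    ∫ x in fundDomain A, f x * trigFun w a b x =
      a * (∫ x in fundDomain A, f x * Real.sin (2 * π * ⟪w, x⟫_ℝ)) +
        b * ∫ x in fundDomain A, f x * Real.cos (2 * π * ⟪w, x⟫_ℝ) := by
  have i1 : IntegrableOn (fun x => f x * Real.sin (2 * π * ⟪w, x⟫_ℝ)) (fundDomain A) :=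
    integrableOn_fundDomain hA (by fun_prop)
  have i2 : IntegrableOn (fun x => f x * Real.cos (2 * π * ⟪w, x⟫_ℝ)) (fundDomain A) :=
    integrableOn_fundDomain hA (by fun_prop)
  rw [← integral_const_mul, ← integral_const_mul,
    ← integral_add (i1.const_mul a) (i2.const_mul b)]
  refine integral_congr_ae (Eventually.of_forall fun x => ?_)
  simp only [trigFun]
  ring

/-- Gradients of trigonometric functions are orthogonal to gradients of functions orthogonal to
the trigonometric functions of the same frequency. -/
lemma integral_inner_gradient_trigFun (hA : IsUnit A.det) {w : E n}
    (hw : w ∈ dualLattice (lattice A)) {f : E n → ℝ} (hf : ContDiff ℝ 1 f)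
    (hp : IsPeriodic (lattice A) f)
    (horth : ∀ a b, ∫ x in fundDomain A, f x * trigFun w a b x = 0) (a b : ℝ) :
    ∫ x in fundDomain A, ⟪gradient (trigFun w a b) x, gradient f x⟫_ℝ = 0 := by
  have ht := contDiff_trigFun w (-b) a (m := 1)
  have h := integral_fderiv_eq_zero hA (hf.mul ht)
    (fun x γ hγ => by rw [hp x γ hγ, periodic_trigFun hw _ _ x γ hγ]) w
  have hd : ∀ x, fderiv ℝ (fun x => f x * trigFun w (-b) a x) x w =
      (2 * π)⁻¹ * ⟪gradient (trigFun w a b) x, gradient f x⟫_ℝ -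
        2 * π * ‖w‖ ^ 2 * (f x * trigFun w a b x) := by
    intro x
    have h2 : HasFDerivAt (fun x => f x * trigFun w (-b) a x) _ x :=
      (hf.differentiable one_ne_zero x).hasFDerivAt.mul (ht.differentiable one_ne_zero x).hasFDerivAt
    have h3 : trigFun w (-a) (-b) x = - trigFun w a b x := by simp only [trigFun]; ring
    rw [h2.fderiv, gradient_trigFun, real_inner_smul_left, inner_gradient_right]
    simp only [add_apply, smul_apply, smul_eq_mul,
      fderiv_trigFun, h3, real_inner_self_eq_norm_sq, conj_trivial]
    have := pi_ne_zero
    field_simp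
    ring
  simp only [hd] at h
  have i1 : IntegrableOn (fun x => ⟪gradient (trigFun w a b) x, gradient f x⟫_ℝ) (fundDomain A) :=
    integrableOn_fundDomain hA
      ((continuous_gradient (contDiff_trigFun w a b)).inner (continuous_gradient hf))
  have i2 : IntegrableOn (fun x => f x * trigFun w a b x) (fundDomain A) :=
    integrableOn_fundDomain hA
      (hf.continuous.mul (contDiff_trigFun (m := 0) w a b).continuous)
  rw [integral_sub (i1.const_mul _) (i2.const_mul _), integral_const_mul, integral_const_mul, horth,
    mul_zero, sub_zero] at h
  simpa [pi_ne_zero] using h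

end Trigonometric

section Rayleigh

variable {n : ℕ} {A : Matrix (Fin n) (Fin n) ℝ}

lemma abs_integral_add_sq_mul_exp_sub_le (hA : IsUnit A.det) {X Y φ : E n → ℝ} (hX : Continuous X)
    (hY : Continuous Y) (hφ : Continuous φ) {c σ η : ℝ} (hs : ∀ x, |c * φ x| ≤ σ) (hσ : σ ≤ 1)
    (hη : 0 < η) (hφX : ∫ x in fundDomain A, φ x * X x ^ 2 = 0)
    (hXY : ∫ x in fundDomain A, Y x * X x = 0) :
    |(∫ x in fundDomain A, (X x + Y x) ^ 2 * Real.exp (c * φ x)) -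
        ((∫ x in fundDomain A, X x ^ 2) + ∫ x in fundDomain A, Y x ^ 2)| ≤
      σ ^ 2 * (1 + 4 / η) * (∫ x in fundDomain A, X x ^ 2) +
        (η + 2 * σ) * ∫ x in fundDomain A, Y x ^ 2 := by
  simpa only [Real.norm_eq_abs, sq_abs] using
    abs_integral_norm_add_sq_mul_exp_sub_le hA hX hY hφ hs hσ hη
      (by simpa only [Real.norm_eq_abs, sq_abs] using hφX) (by simpa using hXY)

lemma abs_integral_exp_sub_le (hA : IsUnit A.det) {φ : E n → ℝ} (hφ : Continuous φ) {c σ η : ℝ}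
    (hs : ∀ x, |c * φ x| ≤ σ) (hσ : σ ≤ 1) (hη : 0 < η)
    (hmean : ∫ x in fundDomain A, φ x = 0) :
    |(∫ x in fundDomain A, Real.exp (c * φ x)) - (|A.det|)| ≤ σ ^ 2 * (1 + 4 / η) * |A.det| := by
  have h := abs_integral_add_sq_mul_exp_sub_le hA (X := fun _ => 1) (Y := fun _ => 0)
    continuous_const continuous_const hφ hs hσ hη (by simpa using hmean) (by simp)
  simpa only [add_zero, one_pow, one_mul, ne_eq, OfNat.ofNat_ne_zero, not_false_eq_true, zero_pow,
    integral_zero, mul_zero, integral_one_fundDomain hA] using h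

lemma integral_mul_norm_sq_gradient_trigFun {w : E n} {φ : E n → ℝ}
    (hφw : ∀ a b, ∫ x in fundDomain A, φ x * trigFun w a b x ^ 2 = 0) (a b : ℝ) :
    ∫ x in fundDomain A, φ x * ‖gradient (trigFun w a b) x‖ ^ 2 = 0 := by
  simp only [norm_sq_gradient_trigFun, mul_left_comm (φ _)]
  rw [integral_const_mul, hφw, mul_zero]

/-- Orthogonal projection off the constants and the trigonometric functions of frequency `w`. -/
lemma exists_trigFun_decomposition (hA : IsUnit A.det) {w : E n}
    (hw : w ∈ dualLattice (lattice A)) (hw0 : w ≠ 0) {f : E n → ℝ} (hf : ContDiff ℝ 1 f)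
    (hp : IsPeriodic (lattice A) f) :
    ∃ c₀ a b : ℝ, ∃ h : E n → ℝ, ContDiff ℝ 1 h ∧ IsPeriodic (lattice A) h ∧
      (∀ x, f x = trigFun w a b x + h x + c₀) ∧ ∫ x in fundDomain A, h x = 0 ∧
      ∀ a' b', ∫ x in fundDomain A, h x * trigFun w a' b' x = 0 := by
  have hD : |A.det| ≠ 0 := abs_ne_zero.2 hA.ne_zero
  have hsin : ∀ x : E n, Real.sin (2 * π * ⟪w, x⟫_ℝ) = trigFun w 1 0 x := by simp [trigFun]
  have hcos : ∀ x : E n, Real.cos (2 * π * ⟪w, x⟫_ℝ) = trigFun w 0 1 x := by simp [trigFun]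
  have hT : ∀ a b, Continuous (trigFun w a b) := fun a b =>
    (contDiff_trigFun (m := 0) w a b).continuous
  have hfc := hf.continuous
  obtain ⟨c₀, hc₀⟩ : ∃ c₀, c₀ = (∫ x in fundDomain A, f x) / |A.det| := ⟨_, rfl⟩
  obtain ⟨a, ha⟩ : ∃ a, a = (∫ x in fundDomain A, f x * trigFun w 1 0 x) / (|A.det| / 2) := ⟨_, rfl⟩
  obtain ⟨b, hb⟩ : ∃ b, b = (∫ x in fundDomain A, f x * trigFun w 0 1 x) / (|A.det| / 2) := ⟨_, rfl⟩
  have hh : ContDiff ℝ 1 fun x => f x - c₀ - trigFun w a b x :=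
    (hf.sub contDiff_const).sub (contDiff_trigFun w a b)
  have hff : IntegrableOn f (fundDomain A) := integrableOn_fundDomain hA hfc
  have hcc : IntegrableOn (fun _ => c₀) (fundDomain A) :=
    integrableOn_fundDomain hA continuous_const
  have hTT : ∀ a b, IntegrableOn (trigFun w a b) (fundDomain A) := fun a b =>
    integrableOn_fundDomain hA (hT a b)
  have hfT : ∀ a b, IntegrableOn (fun x => f x * trigFun w a b x) (fundDomain A) := fun a b =>
    integrableOn_fundDomain hA (hfc.mul (hT a b))
  have hTm : ∀ a' b', IntegrableOn (fun x => trigFun w a b x * trigFun w a' b' x)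
      (fundDomain A) := fun a' b' => integrableOn_fundDomain hA ((hT a b).mul (hT a' b'))
  have hc₀' : ∫ _ in fundDomain A, c₀ = ∫ x in fundDomain A, f x := by
    have := integral_const_mul (μ := volume.restrict (fundDomain A)) c₀ fun _ => (1 : ℝ)
    rw [integral_one_fundDomain hA, hc₀, div_mul_cancel₀ _ hD] at this
    simpa [hc₀] using this
  have hpol : ∀ a' b', ∫ x in fundDomain A, trigFun w a b x * trigFun w a' b' x =
      (a * a' + b * b') / 2 * |A.det| := by
    intro a' b'
    have e : ∀ x, trigFun w a b x * trigFun w a' b' x = 4⁻¹ * trigFun w (a + a') (b + b') x ^ 2 -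
        4⁻¹ * trigFun w (a - a') (b - b') x ^ 2 := by
      intro x; simp only [trigFun]; ring
    have i : ∀ a b, IntegrableOn (fun x => trigFun w a b x ^ 2) (fundDomain A) := fun a b =>
      integrableOn_fundDomain hA ((hT a b).pow 2)
    simp only [e]
    rw [integral_sub ((i _ _).const_mul _) ((i _ _).const_mul _), integral_const_mul,
      integral_const_mul, integral_trigFun_sq hA hw hw0, integral_trigFun_sq hA hw hw0]
    ring
  have key : ∀ a' b', ∫ x in fundDomain A, (f x - c₀ - trigFun w a b x) * trigFun w a' b' x =
      (∫ x in fundDomain A, f x * trigFun w a' b' x) - (a * a' + b * b') / 2 * |A.det| := by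
    intro a' b'
    have e : ∀ x, (f x - c₀ - trigFun w a b x) * trigFun w a' b' x = f x * trigFun w a' b' x -
        c₀ * trigFun w a' b' x - trigFun w a b x * trigFun w a' b' x := fun x => by ring
    have i : IntegrableOn (fun x => f x * trigFun w a' b' x - c₀ * trigFun w a' b' x)
      (fundDomain A) := (hfT a' b').sub ((hTT a' b').const_mul c₀)
    simp only [e]
    rw [integral_sub i (hTm a' b'), integral_sub (hfT a' b') ((hTT a' b').const_mul c₀),
      integral_const_mul, integral_trigFun hA hw hw0, hpol]
    ring
  refine ⟨c₀, a, b, fun x => f x - c₀ - trigFun w a b x, hh, fun x γ hγ => ?_, fun x => by ring,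
    ?_, fun a' b' => ?_⟩
  · simp only [hp x γ hγ, periodic_trigFun hw a b x γ hγ]
  · have i : IntegrableOn (fun x => f x - c₀) (fundDomain A) := hff.sub hcc
    rw [integral_sub i (hTT a b), integral_sub hff hcc, hc₀', integral_trigFun hA hw hw0]
    ring
  · rw [integral_mul_trigFun hA hh.continuous]
    simp only [hsin, hcos]
    rw [key, key, ha, hb]
    field_simp
    ring

lemma rayleigh_lower_bound (hA : IsUnit A.det) {w : E n}
    (hw : w ∈ dualLattice (lattice A)) (hw0 : w ≠ 0) {ν : ℝ}
    (hν : ∀ k : Fin n → ℤ, dualFreq A k ≠ 0 → dualFreq A k ≠ w →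
      dualFreq A k ≠ -w → ν ≤ 4 * π ^ 2 * ‖dualFreq A k‖ ^ 2)
    {φ : E n → ℝ} (hφ : Continuous φ)
    (hφw : ∀ a b, ∫ x in fundDomain A, φ x * trigFun w a b x ^ 2 = 0)
    {c d σ η : ℝ} (hc : ∀ x, |c * φ x| ≤ σ) (hd : ∀ x, |d * φ x| ≤ σ) (hσ : σ ≤ 1) (hη : 0 < η)
    (hτ : σ ^ 2 * (1 + 4 / η) ≤ 1) (hκ1 : η + 2 * σ ≤ 1)
    (hκ : 4 * π ^ 2 * ‖w‖ ^ 2 * (1 + (η + 2 * σ)) ≤ ν * (1 - (η + 2 * σ)))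
    {f : E n → ℝ} (hf : ContDiff ℝ 1 f) (hp : IsPeriodic (lattice A) f)
    (h0 : ∫ x in fundDomain A, f x * Real.exp (c * φ x) = 0) :
    4 * π ^ 2 * ‖w‖ ^ 2 * (1 - σ ^ 2 * (1 + 4 / η)) *
        (∫ x in fundDomain A, f x ^ 2 * Real.exp (c * φ x)) ≤
      (1 + σ ^ 2 * (1 + 4 / η)) *
        ∫ x in fundDomain A, ‖gradient f x‖ ^ 2 * Real.exp (d * φ x) := by
  obtain ⟨c₀, a, b, h, hh, hhp, hfh, hh0, hhT⟩ := exists_trigFun_decomposition hA hw hw0 hf hp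
  have hT : ContDiff ℝ 1 (trigFun w a b) := contDiff_trigFun w a b
  have hfc := hf.continuous
  have hhc := hh.continuous
  have hTc := hT.continuous
  have hden := abs_integral_add_sq_mul_exp_sub_le hA hTc hhc hφ hc hσ hη (hφw a b) (hhT a b)
  have hnum := abs_integral_norm_add_sq_mul_exp_sub_le hA (continuous_gradient hT)
    (continuous_gradient hh) hφ hd hσ hη (integral_mul_norm_sq_gradient_trigFun hφw a b)
    (integral_inner_gradient_trigFun hA hw hh hhp hhT a b)
  have hgrad : ∀ x, gradient (trigFun w a b) x + gradient h x = gradient f x := by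
    intro x
    have hfe : f = fun x => trigFun w a b x + h x + c₀ := funext hfh
    refine ext_inner_right ℝ fun u => ?_
    have : HasFDerivAt f (fderiv ℝ (trigFun w a b) x + fderiv ℝ h x) x := by
      rw [hfe]
      exact ((hT.differentiable one_ne_zero x).hasFDerivAt.add
        (hh.differentiable one_ne_zero x).hasFDerivAt).add_const c₀
    rw [inner_add_left, inner_gradient_left, inner_gradient_left, inner_gradient_left, this.fderiv,
      add_apply]
  simp only [hgrad] at hnum
  rw [integral_norm_sq_gradient_trigFun hA hw hw0] at hnum
  have hpoin := poincare_of_orthogonal hA hν hh hhp hh0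
    (by simpa [trigFun] using hhT 1 0) (by simpa [trigFun] using hhT 0 1)
  have hle : ∫ x in fundDomain A, f x ^ 2 * Real.exp (c * φ x) ≤
      ∫ x in fundDomain A, (trigFun w a b x + h x) ^ 2 * Real.exp (c * φ x) := by
    have e : ∀ x, (trigFun w a b x + h x) ^ 2 * Real.exp (c * φ x) =
        f x ^ 2 * Real.exp (c * φ x) - 2 * c₀ * (f x * Real.exp (c * φ x)) +
          c₀ ^ 2 * Real.exp (c * φ x) := by
      intro x; rw [hfh x]; ring
    have i1 : IntegrableOn (fun x => f x ^ 2 * Real.exp (c * φ x)) (fundDomain A) :=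
      integrableOn_fundDomain hA (by fun_prop)
    have i2 : IntegrableOn (fun x => 2 * c₀ * (f x * Real.exp (c * φ x))) (fundDomain A) :=
      integrableOn_fundDomain hA (by fun_prop)
    have i3 : IntegrableOn (fun x => c₀ ^ 2 * Real.exp (c * φ x)) (fundDomain A) :=
      integrableOn_fundDomain hA (by fun_prop)
    have i12 : IntegrableOn (fun x => f x ^ 2 * Real.exp (c * φ x) -
      2 * c₀ * (f x * Real.exp (c * φ x))) (fundDomain A) := i1.sub i2
    simp only [e]
    rw [integral_add i12 i3, integral_sub i1 i2, integral_const_mul, h0]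
    have : 0 ≤ ∫ x in fundDomain A, c₀ ^ 2 * Real.exp (c * φ x) :=
      integral_nonneg fun x => by positivity
    linarith
  have hP : 0 ≤ ∫ x in fundDomain A, trigFun w a b x ^ 2 := integral_nonneg fun x => by positivity
  have hH : 0 ≤ ∫ x in fundDomain A, h x ^ 2 := integral_nonneg fun x => by positivity
  have hσ0 : 0 ≤ σ := (abs_nonneg _).trans (hc 0)
  have hτ0 : 0 ≤ σ ^ 2 * (1 + 4 / η) := by positivity
  have hκ0 : 0 ≤ η + 2 * σ := by positivity
  have hL : 0 ≤ 4 * π ^ 2 * ‖w‖ ^ 2 := by positivity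
  generalize 4 * π ^ 2 * ‖w‖ ^ 2 = L at *
  generalize σ ^ 2 * (1 + 4 / η) = τ at *
  generalize η + 2 * σ = κ at *
  generalize (∫ x in fundDomain A, trigFun w a b x ^ 2) = P at *
  generalize (∫ x in fundDomain A, h x ^ 2) = H at *
  generalize (∫ x in fundDomain A, ‖gradient h x‖ ^ 2) = G at *
  generalize (∫ x in fundDomain A, f x ^ 2 * Real.exp (c * φ x)) = M at *
  generalize (∫ x in fundDomain A, ‖gradient f x‖ ^ 2 * Real.exp (d * φ x)) = N at *
  have hM : M ≤ (1 + τ) * P + (1 + κ) * H := by linarith [(abs_le.1 hden).2]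
  have hN : (1 - τ) * (L * P) + (1 - κ) * G ≤ N := by linarith [(abs_le.1 hnum).1]
  have hN' : (1 - τ) * (L * P) + (1 - κ) * (ν * H) ≤ N := by
    have := mul_le_mul_of_nonneg_left hpoin (sub_nonneg.2 hκ1)
    linarith
  calc L * (1 - τ) * M ≤ L * (1 - τ) * ((1 + τ) * P + (1 + κ) * H) :=
        mul_le_mul_of_nonneg_left hM (mul_nonneg hL (by linarith))
    _ = (1 + τ) * ((1 - τ) * (L * P)) + (1 - τ) * (L * (1 + κ) * H) := by ring
    _ ≤ (1 + τ) * ((1 - τ) * (L * P)) + (1 + τ) * (ν * (1 - κ) * H) := by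
        have h1 := mul_le_mul_of_nonneg_right hκ hH
        have h2 : 0 ≤ ν * (1 - κ) * H := (by positivity : 0 ≤ L * (1 + κ) * H) |>.trans h1
        exact add_le_add le_rfl (mul_le_mul (by linarith) h1 (by positivity) (by linarith))
    _ = (1 + τ) * ((1 - τ) * (L * P) + (1 - κ) * (ν * H)) := by ring
    _ ≤ (1 + τ) * N := mul_le_mul_of_nonneg_left hN' (by linarith)

/-- The test function for the upper bound: a sine corrected to have weighted mean zero. -/
lemma exists_rayleigh_test (hA : IsUnit A.det) {w : E n}
    (hw : w ∈ dualLattice (lattice A)) (hw0 : w ≠ 0) {φ : E n → ℝ} (hφ : Continuous φ)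
    (hφw : ∀ a b, ∫ x in fundDomain A, φ x * trigFun w a b x ^ 2 = 0)
    {c d σ η : ℝ} (hc : ∀ x, |c * φ x| ≤ σ) (hd : ∀ x, |d * φ x| ≤ σ) (hσ : σ ≤ 1) (hη : 0 < η)
    (hκ1 : η + 2 * σ ≤ 1) :
    ∃ f : E n → ℝ, ContDiff ℝ (⊤ : ℕ∞) f ∧ IsPeriodic (lattice A) f ∧
      ∫ x in fundDomain A, f x * Real.exp (c * φ x) = 0 ∧
      (1 - σ ^ 2 * (1 + 4 / η)) * (|A.det| / 2) ≤
        ∫ x in fundDomain A, f x ^ 2 * Real.exp (c * φ x) ∧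
      ∫ x in fundDomain A, ‖gradient f x‖ ^ 2 * Real.exp (d * φ x) ≤
        (1 + σ ^ 2 * (1 + 4 / η)) * (4 * π ^ 2 * ‖w‖ ^ 2 * (|A.det| / 2)) := by
  have hTs : ContDiff ℝ (⊤ : ℕ∞) (trigFun w 1 0) := contDiff_trigFun w 1 0
  have hTc := hTs.continuous
  have hT1 : ContDiff ℝ 1 (trigFun w 1 0) := contDiff_trigFun w 1 0
  have hσ0 : 0 ≤ σ := (abs_nonneg _).trans (hc 0)
  have hi : IntegrableOn (fun x => Real.exp (c * φ x)) (fundDomain A) :=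
    integrableOn_fundDomain hA (by fun_prop)
  have hiT : IntegrableOn (fun x => trigFun w 1 0 x * Real.exp (c * φ x)) (fundDomain A) :=
    integrableOn_fundDomain hA (by fun_prop)
  have hW : 0 < ∫ x in fundDomain A, Real.exp (c * φ x) := by
    have hlow : Real.exp (-σ) * |A.det| ≤ ∫ x in fundDomain A, Real.exp (c * φ x) := by
      rw [← integral_one_fundDomain hA, ← integral_const_mul]
      refine integral_mono (integrableOn_fundDomain hA (by fun_prop)) hi fun x => ?_
      simpa using (abs_le.1 (hc x)).1
    exact (mul_pos (Real.exp_pos _) (abs_pos.2 hA.ne_zero)).trans_le hlow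
  obtain ⟨m, hm⟩ : ∃ m, m = (∫ x in fundDomain A, trigFun w 1 0 x * Real.exp (c * φ x)) /
    ∫ x in fundDomain A, Real.exp (c * φ x) := ⟨_, rfl⟩
  have hgrad : ∀ x, gradient (fun x => trigFun w 1 0 x + -m) x = gradient (trigFun w 1 0) x := by
    intro x
    rw [gradient, gradient, fderiv_add_const]
  refine ⟨fun x => trigFun w 1 0 x + -m, hTs.add contDiff_const, fun x γ hγ => ?_, ?_, ?_, ?_⟩
  · simp only [periodic_trigFun hw 1 0 x γ hγ]
  · simp only [add_mul]
    rw [integral_add hiT (hi.const_mul _), integral_const_mul, hm]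
    field_simp
    ring
  · have h := abs_integral_add_sq_mul_exp_sub_le hA hTc (continuous_const (y := -m)) hφ hc hσ hη
      (hφw 1 0) (by rw [integral_const_mul, integral_trigFun hA hw hw0, mul_zero])
    rw [integral_trigFun_sq hA hw hw0] at h
    have hY : 0 ≤ ∫ _ in fundDomain A, (-m) ^ 2 := integral_nonneg fun x => by positivity
    have h1 := mul_le_mul_of_nonneg_right hκ1 hY
    linarith [(abs_le.1 h).1]
  · have h := abs_integral_norm_add_sq_mul_exp_sub_le hA (continuous_gradient hT1)
      (continuous_const (y := (0 : E n))) hφ hd hσ hη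
      (integral_mul_norm_sq_gradient_trigFun hφw 1 0) (by simp)
    simp only [add_zero, norm_zero, ne_eq, OfNat.ofNat_ne_zero, not_false_eq_true, zero_pow,
      integral_zero, mul_zero] at h
    rw [integral_norm_sq_gradient_trigFun hA hw hw0, integral_trigFun_sq hA hw hw0] at h
    simp only [hgrad]
    linarith [(abs_le.1 h).2]

end Rayleigh

section Eigenvalue

lemma abs_mul_rpow_sub_le {L V lam D τ p : ℝ} (hlam : 0 ≤ lam) (hD : 0 < D) (hτ0 : 0 ≤ τ)
    (hτ : τ ≤ 1 / 4) (hp0 : 0 ≤ p) (hp1 : p ≤ 1) (h1 : lam * (1 - τ) ≤ L * (1 + τ))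
    (h2 : L * (1 - τ) ≤ lam * (1 + τ)) (hV : |V - D| ≤ τ * D) :
    |L * V ^ p - lam * D ^ p| ≤ 8 * τ * (lam * D ^ p) := by
  obtain ⟨v, rfl⟩ : ∃ v, V = D * v := ⟨V / D, by field_simp⟩
  obtain ⟨hV1, hV2⟩ := abs_le.1 hV
  have hv1 : 1 - τ ≤ v := by
    refine le_of_mul_le_mul_left ?_ hD
    linarith
  have hv2 : v ≤ 1 + τ := by
    refine le_of_mul_le_mul_left ?_ hD
    linarith
  have hv0 : 0 ≤ v := by linarith
  have hL : 0 ≤ L := by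
    have : 0 ≤ lam * (1 - τ) := mul_nonneg hlam (by linarith)
    exact nonneg_of_mul_nonneg_left (this.trans h1) (by linarith)
  have hq1 : 1 - τ ≤ v ^ p := by
    calc 1 - τ = (1 - τ) ^ (1 : ℝ) := (Real.rpow_one _).symm
      _ ≤ (1 - τ) ^ p :=
        Real.rpow_le_rpow_of_exponent_ge (by linarith) (by linarith) hp1
      _ ≤ v ^ p := Real.rpow_le_rpow (by linarith) hv1 hp0
  have hq2 : v ^ p ≤ 1 + τ := by
    calc v ^ p ≤ (1 + τ) ^ p := Real.rpow_le_rpow hv0 hv2 hp0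
      _ ≤ (1 + τ) ^ (1 : ℝ) := Real.rpow_le_rpow_of_exponent_le (by linarith) hp1
      _ = 1 + τ := Real.rpow_one _
  rw [Real.mul_rpow hD.le hv0]
  have hDp : 0 ≤ D ^ p := Real.rpow_nonneg hD.le p
  have hkey : |L * v ^ p - lam| ≤ 8 * τ * lam := by
    rw [abs_le]
    constructor
    · have a1 : L * (1 - τ) ≤ L * v ^ p := mul_le_mul_of_nonneg_left hq1 hL
      have a2 : lam * (1 - 8 * τ) * (1 + τ) ≤ L * (1 - τ) * (1 + τ) := by
        nlinarith [mul_le_mul_of_nonneg_right h1 (by linarith : 0 ≤ 1 - τ), mul_nonneg hlam hτ0,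
          mul_nonneg (mul_nonneg hlam hτ0) hτ0]
      have a3 := le_of_mul_le_mul_right a2 (by linarith)
      linarith
    · have a1 : L * v ^ p ≤ L * (1 + τ) := mul_le_mul_of_nonneg_left hq2 hL
      have a2 : L * (1 + τ) * (1 - τ) ≤ lam * (1 + 8 * τ) * (1 - τ) := by
        nlinarith [mul_le_mul_of_nonneg_right h2 (by linarith : 0 ≤ 1 + τ), mul_nonneg hlam hτ0,
          mul_nonneg (mul_nonneg hlam hτ0) (by linarith : 0 ≤ 1 / 4 - τ)]
      have a3 := le_of_mul_le_mul_right a2 (by linarith)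
      linarith
  have e : L * (D ^ p * v ^ p) - lam * D ^ p = (L * v ^ p - lam) * D ^ p := by ring
  rw [e, abs_mul, abs_of_nonneg hDp]
  linarith [mul_le_mul_of_nonneg_right hkey hDp]

variable {n : ℕ} {A : Matrix (Fin n) (Fin n) ℝ}

lemma integral_sq_mul_exp_pos (hA : IsUnit A.det) {f φ : E n → ℝ} (hf : Continuous f)
    (hφ : Continuous φ) (hp : IsPeriodic (lattice A) f) (hf0 : f ≠ 0) (c : ℝ) :
    0 < ∫ x in fundDomain A, f x ^ 2 * Real.exp (c * φ x) := by
  have hn : 0 ≤ fun x => f x ^ 2 * Real.exp (c * φ x) := fun x => by positivity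
  refine lt_of_le_of_ne (integral_nonneg hn) fun h => hf0 ?_
  have h' := (integral_eq_zero_iff_of_nonneg hn
    (integrableOn_fundDomain hA (by fun_prop))).1 h.symm
  refine eq_zero_of_ae_fundDomain hA hf hp ?_
  filter_upwards [h'] with x hx
  simpa [Real.exp_ne_zero] using hx

lemma confLam1_bounds (hA : IsUnit A.det) {w : E n}
    (hw : w ∈ dualLattice (lattice A)) (hw0 : w ≠ 0) {ν : ℝ}
    (hν : ∀ k : Fin n → ℤ, dualFreq A k ≠ 0 → dualFreq A k ≠ w →
      dualFreq A k ≠ -w → ν ≤ 4 * π ^ 2 * ‖dualFreq A k‖ ^ 2)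
    {φ : E n → ℝ} (hφ : Continuous φ)
    (hφw : ∀ a b, ∫ x in fundDomain A, φ x * trigFun w a b x ^ 2 = 0)
    {t σ η : ℝ} (hc : ∀ x, |n * t / 2 * φ x| ≤ σ) (hd : ∀ x, |(n - 2) * t / 2 * φ x| ≤ σ)
    (hσ : σ ≤ 1) (hη : 0 < η) (hτ : σ ^ 2 * (1 + 4 / η) ≤ 1 / 4) (hκ1 : η + 2 * σ ≤ 1)
    (hκ : 4 * π ^ 2 * ‖w‖ ^ 2 * (1 + (η + 2 * σ)) ≤ ν * (1 - (η + 2 * σ))) :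
    4 * π ^ 2 * ‖w‖ ^ 2 * (1 - σ ^ 2 * (1 + 4 / η)) ≤
        confLam1 A φ t * (1 + σ ^ 2 * (1 + 4 / η)) ∧
      confLam1 A φ t * (1 - σ ^ 2 * (1 + 4 / η)) ≤
        4 * π ^ 2 * ‖w‖ ^ 2 * (1 + σ ^ 2 * (1 + 4 / η)) := by
  have ec : ∀ x, (n : ℝ) * t * φ x / 2 = n * t / 2 * φ x := fun x => by ring
  have ed : ∀ x, ((n : ℝ) - 2) * t * φ x / 2 = (n - 2) * t / 2 * φ x := fun x => by ring
  obtain ⟨f, hf, hfp, hfm, hden, hnum⟩ :=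
    exists_rayleigh_test hA hw hw0 hφ hφw hc hd hσ hη hκ1
  have hD : 0 < |A.det| := abs_pos.2 hA.ne_zero
  have hτ0 : 0 ≤ σ ^ 2 * (1 + 4 / η) := by positivity
  have hL : 0 ≤ 4 * π ^ 2 * ‖w‖ ^ 2 := by positivity
  have hden0 : 0 < ∫ x in fundDomain A, f x ^ 2 * Real.exp (n * t / 2 * φ x) :=
    (mul_pos (by linarith) (by linarith)).trans_le hden
  have hf0 : f ≠ 0 := by
    rintro rfl
    simp at hden0
  unfold confLam1
  simp only [ec, ed]
  constructor
  · rw [← div_le_iff₀ (by linarith)]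
    refine le_csInf ⟨_, f, hf, hfp, hf0, hfm, rfl⟩ ?_
    rintro r ⟨g, hg, hgp, hg0, hgm, rfl⟩
    have hgd := integral_sq_mul_exp_pos hA hg.continuous hφ hgp hg0 (n * t / 2)
    rw [div_le_div_iff₀ (by linarith) hgd, mul_comm (∫ x in fundDomain A, _ * _) (1 + _)]
    exact rayleigh_lower_bound hA hw hw0 hν hφ hφw hc hd hσ hη (by linarith) hκ1 hκ
      (hg.of_le (by exact_mod_cast le_top)) hgp hgm
  · rw [← le_div_iff₀ (by linarith)]
    refine le_trans (csInf_le ⟨0, ?_⟩ ⟨f, hf, hfp, hf0, hfm, rfl⟩) ?_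
    · rintro r ⟨g, -, -, -, -, rfl⟩
      exact div_nonneg (integral_nonneg fun x => by positivity)
        (integral_nonneg fun x => by positivity)
    · rw [div_le_div_iff₀ hden0 (by linarith)]
      have h1 := mul_le_mul_of_nonneg_right hnum
        (by linarith : 0 ≤ 1 - σ ^ 2 * (1 + 4 / η))
      have h2 := mul_le_mul_of_nonneg_left hden
        (by positivity : 0 ≤ 4 * π ^ 2 * ‖w‖ ^ 2 * (1 + σ ^ 2 * (1 + 4 / η)))
      linarith

lemma integral_mul_trigFun_sq_eq_zero (hA : IsUnit A.det) {w : E n} {φ : E n → ℝ}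
    (hφ : Continuous φ)
    (horth : ∀ i j : Fin 2, ∫ x in fundDomain A,
      φ x * (![uSin A w, uCos A w] : Fin 2 → E n → ℝ) i x *
        (![uSin A w, uCos A w] : Fin 2 → E n → ℝ) j x = 0) (a b : ℝ) :
    ∫ x in fundDomain A, φ x * trigFun w a b x ^ 2 = 0 := by
  have hs : Real.sqrt 2 / Real.sqrt |A.det| ≠ 0 := by
    have := Real.sqrt_pos.2 (abs_pos.2 hA.ne_zero)
    positivity
  have h11 := horth 0 0
  have h12 := horth 0 1
  have h22 := horth 1 1
  simp only [Matrix.cons_val_zero, Matrix.cons_val_one, uSin, uCos] at h11 h12 h22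
  generalize Real.sqrt 2 / Real.sqrt |A.det| = s at *
  have e : ∀ x, φ x * trigFun w a b x ^ 2 =
      (a / s) ^ 2 * (φ x * (s * Real.sin (2 * π * ⟪w, x⟫_ℝ)) * (s * Real.sin (2 * π * ⟪w, x⟫_ℝ))) +
      2 * (a / s) * (b / s) *
        (φ x * (s * Real.sin (2 * π * ⟪w, x⟫_ℝ)) * (s * Real.cos (2 * π * ⟪w, x⟫_ℝ))) +
      (b / s) ^ 2 *
        (φ x * (s * Real.cos (2 * π * ⟪w, x⟫_ℝ)) * (s * Real.cos (2 * π * ⟪w, x⟫_ℝ))) := by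
    intro x
    simp only [trigFun]
    field_simp
    ring
  simp only [e]
  rw [integral_add, integral_add, integral_const_mul, integral_const_mul, integral_const_mul, h11,
    h12, h22]
  · simp
  all_goals exact integrableOn_fundDomain hA (by fun_prop)

end Eigenvalue

/-- Vanishing of the first variation of the normalized first eigenvalue along an
admissible conformal deformation: `λ₁(t)·V_φ(t)^{2/n} = λ₁·D^{2/n} + o(t)` as `t → 0`. -/
theorem statement7 (n : ℕ) (hn : 2 ≤ n) (A : Matrix (Fin n) (Fin n) ℝ) (hA : IsUnit A.det)
    (w : E n) (hgap : GapCondition (lattice A) w)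
    (lam₁ : ℝ) (hlam₁ : lam₁ = 4 * π ^ 2 * ‖w‖ ^ 2)
    (u : Fin 2 → (E n → ℝ)) (hu : u = ![uSin A w, uCos A w])
    (φ : E n → ℝ) (hφ : ContDiff ℝ (⊤ : ℕ∞) φ) (hper : IsPeriodic (lattice A) φ)
    (hmean : (∫ x in fundDomain A, φ x) = 0)
    (horth₁ : ∀ i j : Fin 2, (∫ x in fundDomain A, φ x * u i x * u j x) = 0)
    (horth₂ : ∀ i j : Fin 2,
      (∫ x in fundDomain A, u i x * ⟪gradient φ x, gradient (u j) x⟫_ℝ) = 0) :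
    (fun t : ℝ => confLam1 A φ t * confVol A φ t ^ ((2 : ℝ) / n)
        - lam₁ * |A.det| ^ ((2 : ℝ) / n))
      =o[𝓝 (0 : ℝ)] fun t => t := by
  subst hu
  obtain ⟨hw, hw0, -⟩ := id hgap
  obtain ⟨ν, hνw, hν⟩ := exists_spectral_gap hA hgap
  have hφc : Continuous φ := hφ.continuous
  have hφw := integral_mul_trigFun_sq_eq_zero hA hφc horth₁
  obtain ⟨M, hM⟩ := exists_bound_of_periodic hA hφc hper
  rw [← hlam₁] at hνw
  have hlam : 0 ≤ lam₁ := by rw [hlam₁]; positivity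
  have hn' : (2 : ℝ) ≤ n := by exact_mod_cast hn
  have hM0 : 0 ≤ M := (norm_nonneg _).trans (hM 0)
  have hsum : 0 < ν + lam₁ := by linarith
  obtain ⟨η, hη⟩ : ∃ η, η = (ν - lam₁) / (ν + lam₁) / 2 := ⟨_, rfl⟩
  have hη0 : 0 < η := by rw [hη]; exact div_pos (div_pos (by linarith) hsum) two_pos
  have hη' : 2 * η * (ν + lam₁) = ν - lam₁ := by rw [hη]; field_simp
  have hη1 : 2 * η ≤ 1 := by
    refine le_of_mul_le_mul_right ?_ hsum
    linarith
  obtain ⟨K, hK⟩ : ∃ K, K = (n : ℝ) / 2 * M := ⟨_, rfl⟩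
  have hc : ∀ t x, |(n : ℝ) * t / 2 * φ x| ≤ K * |t| := by
    intro t x
    have e : (n : ℝ) * t / 2 * φ x = n / 2 * φ x * t := by ring
    rw [e, abs_mul, abs_mul, abs_of_nonneg (by positivity : (0 : ℝ) ≤ n / 2), hK]
    gcongr
    exact hM x
  have hd : ∀ t x, |((n : ℝ) - 2) * t / 2 * φ x| ≤ K * |t| := by
    intro t x
    refine le_trans ?_ (hc t x)
    rw [mul_div_assoc, mul_div_assoc, mul_assoc, mul_assoc, abs_mul, abs_mul (n : ℝ)]
    gcongr
    linarith
  have hcont : ∀ f : ℝ → ℝ, Continuous f → f 0 = 0 → ∀ ε > 0, ∀ᶠ t in 𝓝 (0 : ℝ), f t ≤ ε := by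
    intro f hf hf0 ε hε
    have := hf.tendsto 0
    rw [hf0] at this
    exact this.eventually (eventually_le_nhds hε)
  have h1 := hcont (fun t => K * |t|) (by fun_prop) (by simp) 1 one_pos
  have h2 := hcont (fun t => K * |t|) (by fun_prop) (by simp) (η / 2) (by positivity)
  have h3 := hcont (fun t => (K * |t|) ^ 2 * (1 + 4 / η)) (by fun_prop) (by simp) (1 / 4)
    (by positivity)
  refine IsBigO.trans_isLittleO (g := fun t : ℝ => t ^ 2) ?_
    (by simpa using isLittleO_pow_pow (𝕜 := ℝ) one_lt_two)
  refine IsBigO.of_bound (8 * (K ^ 2 * (1 + 4 / η)) * (lam₁ * |A.det| ^ ((2 : ℝ) / n))) ?_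
  filter_upwards [h1, h2, h3] with t h1 h2 h3
  have hκ1 : η + 2 * (K * |t|) ≤ 2 * η := by linarith
  obtain ⟨hl, hu⟩ := confLam1_bounds hA hw hw0 hν hφc hφw (hc t) (hd t) h1 hη0 h3
    (by linarith) (by
      rw [← hlam₁]
      have := mul_le_mul_of_nonneg_right hκ1 hsum.le
      linarith)
  rw [← hlam₁] at hl hu
  have hV : |confVol A φ t - (|A.det|)| ≤ (K * |t|) ^ 2 * (1 + 4 / η) * |A.det| := by
    have e : ∀ x, (n : ℝ) * t * φ x / 2 = n * t / 2 * φ x := fun x => by ring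
    simpa only [confVol, e] using abs_integral_exp_sub_le hA hφc (hc t) h1 hη0 hmean
  have hp1 : (2 : ℝ) / n ≤ 1 := (div_le_one (by linarith)).2 hn'
  have := abs_mul_rpow_sub_le hlam (abs_pos.2 hA.ne_zero) (by positivity) h3 (by positivity) hp1
    hl hu hV
  rw [Real.norm_eq_abs, Real.norm_eq_abs, abs_of_nonneg (sq_nonneg t)]
  refine this.trans (le_of_eq ?_)
  rw [mul_pow, sq_abs]
  ring
end
end
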